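/- Let d ≥ 1 and 1 ≤ i_1 ≤ i_2 ≤ i_3 ≤ d be integers. There exists a lattice polytope P ⊂ ℝ^d of dimension d whose δ-polynomial equals 1 + t^{i_1} + t^{i_2} + t^{i_3} if and only if i_3 ≤ i_1 + i_2, i_1 + i_3 ≤ d + 1, i_2 ≤ ⌊(d+1)/2⌋, and in addition 2i_2 ≤ i_1 + i_3 or i_2 + i_3 ≤ d + 1. -/

import Mathlib

open Pointwise Polynomial

noncomputable section

/-- The set of lattice points of `ℝ^d` (points with integer coordinates). -/
def latticePts (d : ℕ) : Set (Fin d → ℝ) := {x | ∀ i, ∃ z : ℤ, x i = (z : ℝ)}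

/-- A lattice polytope: the convex hull of finitely many lattice points. -/
def IsLatticePolytope {d : ℕ} (P : Set (Fin d → ℝ)) : Prop :=
  ∃ V : Finset (Fin d → ℝ), (V : Set (Fin d → ℝ)) ⊆ latticePts d ∧
    P = convexHull ℝ (V : Set (Fin d → ℝ))

/-- `|nP ∩ ℤ^d|`. -/
def ehrhartCount {d : ℕ} (P : Set (Fin d → ℝ)) (n : ℕ) : ℕ :=
  (latticePts d ∩ (n : ℝ) • P).ncard

/-- The Ehrhart series `1 + Σ_{n ≥ 1} |nP ∩ ℤ^d| tⁿ`. -/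
def ehrhartSeries {d : ℕ} (P : Set (Fin d → ℝ)) : PowerSeries ℤ :=
  PowerSeries.mk fun n => if n = 0 then 1 else (ehrhartCount P n : ℤ)

/-- `p` is the δ-polynomial of the lattice polytope `P ⊆ ℝ^d` of dimension `d`,
i.e. `(1 - t)^(d+1) (1 + Σ_{n ≥ 1} |nP ∩ ℤ^d| tⁿ) = p`. -/
def HasDeltaPoly {d : ℕ} (P : Set (Fin d → ℝ)) (p : Polynomial ℤ) : Prop :=
  (1 - PowerSeries.X) ^ (d + 1) * ehrhartSeries P = (p : PowerSeries ℤ)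

/-- Unimodular equivalence: an affine map carrying `ℤ^d ∩ aff P` bijectively onto
`ℤ^e ∩ aff Q` and mapping `P` onto `Q`. -/
def UnimodEquiv {d e : ℕ} (P : Set (Fin d → ℝ)) (Q : Set (Fin e → ℝ)) : Prop :=
  ∃ f : (Fin d → ℝ) →ᵃ[ℝ] (Fin e → ℝ),
    Set.BijOn f (latticePts d ∩ (affineSpan ℝ P : Set (Fin d → ℝ)))
      (latticePts e ∩ (affineSpan ℝ Q : Set (Fin e → ℝ))) ∧ f '' P = Q

/-- The lattice pyramid `Pyr(Q) = conv(Q × {0}, (0,…,0,1)) ⊆ ℝ^{e+1}`. -/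
def pyramidOver {e : ℕ} (Q : Set (Fin e → ℝ)) : Set (Fin (e + 1) → ℝ) :=
  convexHull ℝ
    ((fun x : Fin e → ℝ => Fin.snoc x (0 : ℝ)) '' Q ∪ {Fin.snoc (0 : Fin e → ℝ) (1 : ℝ)})

/-- `P` is a lattice pyramid over some (full-dimensional) lattice polytope. -/
def IsLatticePyramid {d : ℕ} (P : Set (Fin d → ℝ)) : Prop :=
  ∃ (e : ℕ) (Q : Set (Fin e → ℝ)), IsLatticePolytope Q ∧ affineSpan ℝ Q = ⊤ ∧
    UnimodEquiv P (pyramidOver Q)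

/-- `P ⊆ ℝ^d` is a simplex (of some dimension). -/
def IsSimplex {d : ℕ} (P : Set (Fin d → ℝ)) : Prop :=
  ∃ (n : ℕ) (v : Fin (n + 1) → Fin d → ℝ), AffineIndependent ℝ v ∧
    P = convexHull ℝ (Set.range v)

/-- A full-dimensional lattice simplex of dimension `d` in `ℝ^d`. -/
def IsLatticeSimplexFD {d : ℕ} (Δ : Set (Fin d → ℝ)) : Prop :=
  ∃ v : Fin (d + 1) → Fin d → ℝ, AffineIndependent ℝ v ∧
    (∀ i, v i ∈ latticePts d) ∧ Δ = convexHull ℝ (Set.range v)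

/-- `ℤ((P,1) ∩ ℤ^{d+1}) = ℤ^{d+1}`: the lattice points of `P`, with last coordinate `1`
appended, generate all of `ℤ^{d+1}` as a group. -/
def SpansLattice {d : ℕ} (P : Set (Fin d → ℝ)) : Prop :=
  AddSubgroup.closure {y : Fin (d + 1) → ℤ |
    y (Fin.last d) = 1 ∧ (fun i : Fin d => (y i.castSucc : ℝ)) ∈ P} = ⊤

/-- The finite abelian group `Λ_Δ ⊆ (ℝ/ℤ)^{d+1}` attached to a lattice simplex with
ordered vertices `v 0, …, v d`, encoded by its canonical representatives in `[0,1)`. -/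
def simplexLambda {d : ℕ} (v : Fin (d + 1) → Fin d → ℝ) : Set (Fin (d + 1) → ℝ) :=
  {c | (∀ i, 0 ≤ c i ∧ c i < 1) ∧
    (∀ j : Fin d, ∃ z : ℤ, (∑ i, c i * v i j) = (z : ℝ)) ∧
    (∃ z : ℤ, (∑ i, c i) = (z : ℝ))}

/-- The standard basis vector `e_j` of `ℝ^d` (0-indexed). -/
def stdE (d : ℕ) (j : Fin d) : Fin d → ℝ := fun i => if i = j then 1 else 0

/-- The power series counting vectors of natural numbers by their sum. -/
theorem one_sub_X_pow_mul_mk_card {κ : Type} [Fintype κ] :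
    (1 - PowerSeries.X : PowerSeries ℤ) ^ Fintype.card κ *
      PowerSeries.mk (fun n => (Nat.card {m : κ → ℕ // ∑ k, m k = n} : ℤ)) = 1 := by
  classical
  have h1 : PowerSeries.mk (fun n => (Nat.card {m : κ → ℕ // ∑ k, m k = n} : ℤ)) =
      ∏ _k : κ, (PowerSeries.mk 1 : PowerSeries ℤ) := by
    ext n
    rw [PowerSeries.coeff_mk, PowerSeries.coeff_prod]
    simp only [PowerSeries.coeff_mk, Pi.one_apply, Finset.prod_const_one, Finset.sum_const,
      nsmul_eq_mul, mul_one]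
    congr 1
    rw [← Nat.card_eq_finsetCard]
    refine Nat.card_congr ?_
    refine (Equiv.subtypeEquiv Finsupp.equivFunOnFinite.symm ?_)
    intro m
    simp [Finset.mem_finsuppAntidiag]
  rw [h1, Finset.prod_const, Finset.card_univ, ← mul_pow, mul_comm,
    PowerSeries.mk_one_mul_one_sub_eq_one, one_pow]

theorem one_sub_X_pow_mul_mk_card_shift {κ : Type} [Fintype κ] (h : ℕ) :
    (1 - PowerSeries.X : PowerSeries ℤ) ^ Fintype.card κ *
      PowerSeries.mk (fun n => (Nat.card {m : κ → ℕ // ∑ k, m k + h = n} : ℤ)) =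
      PowerSeries.X ^ h := by
  have h1 : PowerSeries.mk (fun n => (Nat.card {m : κ → ℕ // ∑ k, m k + h = n} : ℤ)) =
      PowerSeries.X ^ h *
        PowerSeries.mk (fun n => (Nat.card {m : κ → ℕ // ∑ k, m k = n} : ℤ)) := by
    ext n
    rw [PowerSeries.coeff_X_pow_mul']
    simp only [PowerSeries.coeff_mk]
    split_ifs with hn
    · congr 1
      exact Nat.card_congr (Equiv.subtypeEquivRight fun m => by omega)
    · have : IsEmpty {m : κ → ℕ // ∑ k, m k + h = n} := ⟨fun m => by have := m.2; omega⟩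
      simp
  rw [h1, mul_left_comm, one_sub_X_pow_mul_mk_card, mul_one]

theorem finite_sum_add_eq {κ : Type} [Fintype κ] (h n : ℕ) :
    Finite {m : κ → ℕ // ∑ k, m k + h = n} := by
  classical
  refine Set.Finite.subset (Set.finite_Iic (fun _ : κ => n)) ?_
  intro m hm k
  have : m k ≤ ∑ k, m k := Finset.single_le_sum (fun _ _ => Nat.zero_le _) (Finset.mem_univ k)
  have hm' : ∑ k, m k + h = n := hm
  change m k ≤ n
  omega

/-- Floor, or the largest integer strictly below, depending on whether the facet is removed. -/
def hfloor (s : Prop) [Decidable s] (t : ℝ) : ℤ := if s then ⌈t⌉ - 1 else ⌊t⌋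

theorem hfloor_add_int (s : Prop) [Decidable s] (t : ℝ) (z : ℤ) :
    hfloor s (t + z) = hfloor s t + z := by
  unfold hfloor
  split_ifs
  · rw [Int.ceil_add_intCast]; ring
  · rw [Int.floor_add_intCast]

theorem hfloor_neg (s : Prop) [Decidable s] [Decidable (¬ s)] (t : ℝ) :
    hfloor (¬ s) (-t) = - hfloor s t - 1 := by
  unfold hfloor
  by_cases h : s
  · simp only [h, not_true_eq_false, if_false, if_true, Int.floor_neg]; ring
  · simp only [h, not_false_eq_true, if_true, if_false, Int.ceil_neg]

theorem hfloor_nonneg_iff (s : Prop) [Decidable s] (t : ℝ) :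
    0 ≤ hfloor s t ↔ (if s then 0 < t else 0 ≤ t) := by
  unfold hfloor
  split_ifs
  · rw [sub_nonneg, Int.one_le_ceil_iff]
  · exact Int.floor_nonneg

theorem hfloor_le (s : Prop) [Decidable s] (t : ℝ) : (hfloor s t : ℝ) ≤ t := by
  unfold hfloor
  split_ifs
  · push_cast
    linarith [Int.ceil_lt_add_one t]
  · exact Int.floor_le t

/-- A lattice `M`, graded by `ht`, with the coordinates of its elements with respect to
the generators `β` (of degree one) of a simplicial cone. -/
structure SimplicialCone (M : Type) [AddCommGroup M] (κ : Type) [Fintype κ] [DecidableEq κ] where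
  crd : M →+ (κ → ℝ)
  crd_injective : Function.Injective crd
  β : κ → M
  crd_β : ∀ k, crd (β k) = Pi.single k 1
  ht : M →+ ℤ
  sum_crd : ∀ x, ∑ k, crd x k = ht x

namespace SimplicialCone

variable {M : Type} [AddCommGroup M] {κ : Type} [Fintype κ] [DecidableEq κ]
  (C : SimplicialCone M κ)

/-- The sublattice generated by the generators. -/
def sub : AddSubgroup M where
  carrier := {x | ∀ k, ∃ z : ℤ, C.crd x k = z}
  zero_mem' := fun k => ⟨0, by simp⟩
  add_mem' := by
    intro x y hx hy k
    obtain ⟨a, ha⟩ := hx k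
    obtain ⟨b, hb⟩ := hy k
    exact ⟨a + b, by simp [ha, hb]⟩
  neg_mem' := by
    intro x hx k
    obtain ⟨a, ha⟩ := hx k
    exact ⟨-a, by simp [ha]⟩

theorem mem_sub {x : M} : x ∈ C.sub ↔ ∀ k, ∃ z : ℤ, C.crd x k = z := Iff.rfl

/-- The finite group of classes of lattice points modulo the generators. -/
abbrev Q : Type := M ⧸ C.sub

open Classical in
/-- The height of the representative of `x` in the half-open fundamental parallelepiped. -/
def hgt (S : Set κ) (x : M) : ℤ := C.ht x - ∑ k, hfloor (k ∈ S) (C.crd x k)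

theorem hgt_add_mem (S : Set κ) (x y : M) (hy : y ∈ C.sub) : C.hgt S (x + y) = C.hgt S x := by
  classical
  choose z hz using hy
  have : (C.ht y : ℝ) = ∑ k, (z k : ℝ) := by
    rw [← C.sum_crd]; exact Finset.sum_congr rfl fun k _ => hz k
  have h2 : C.ht y = ∑ k, z k := by exact_mod_cast this
  simp only [hgt, map_add, Pi.add_apply, hz, hfloor_add_int, Finset.sum_add_distrib, h2]
  ring

theorem hgt_congr (S : Set κ) {x y : M} (h : (x : C.Q) = y) : C.hgt S x = C.hgt S y := by
  have := (QuotientAddGroup.eq).1 h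
  rw [← C.hgt_add_mem S x _ this]
  congr 1
  abel

theorem hgt_nonneg (S : Set κ) (x : M) : 0 ≤ C.hgt S x := by
  classical
  have : (0 : ℝ) ≤ (C.hgt S x : ℝ) := by
    rw [hgt]
    push_cast
    rw [← C.sum_crd, ← Finset.sum_sub_distrib]
    exact Finset.sum_nonneg fun k _ => sub_nonneg.2 (hfloor_le _ _)
  exact_mod_cast this

theorem hgt_compl_neg (S : Set κ) (x : M) :
    C.hgt Sᶜ (-x) = Fintype.card κ - C.hgt S x := by
  classical
  have h : ∀ k, hfloor (k ∈ Sᶜ) (C.crd (-x) k) = - hfloor (k ∈ S) (C.crd x k) - 1 := by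
    intro k
    have h := hfloor_neg (k ∈ S) (C.crd x k)
    rw [map_neg, Pi.neg_apply]
    convert h
  have h' : C.hgt Sᶜ (-x) = C.ht (-x) - ∑ k, hfloor (k ∈ Sᶜ) (C.crd (-x) k) := by
    unfold hgt; congr!
  rw [h', hgt, map_neg, Finset.sum_congr rfl fun k _ => h k, Finset.sum_sub_distrib,
    Finset.sum_neg_distrib]
  simp
  ring

/-- The height of a class, as a natural number. -/
def qhgt (S : Set κ) (q : C.Q) : ℕ := (C.hgt S q.out).toNat

theorem qhgt_mk (S : Set κ) (x : M) : (C.qhgt S (x : C.Q) : ℤ) = C.hgt S x := by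
  rw [qhgt, Int.toNat_of_nonneg (C.hgt_nonneg S _)]
  exact C.hgt_congr S (Quotient.out_eq _)

theorem qhgt_compl_neg (S : Set κ) (q : C.Q) :
    C.qhgt Sᶜ (-q) = Fintype.card κ - C.qhgt S q := by
  induction q using QuotientAddGroup.induction_on with
  | _ x =>
    have h1 := C.qhgt_mk S x
    have h2 := C.qhgt_mk Sᶜ (-x)
    have h3 := C.hgt_compl_neg S x
    rw [QuotientAddGroup.mk_neg] at h2
    omega

theorem crd_sum_β (m : κ → ℤ) : C.crd (∑ k, m k • C.β k) = fun k => (m k : ℝ) := by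
  ext k
  simp [map_sum, C.crd_β, Finset.sum_apply, Pi.single_apply]

theorem sum_β_mem (m : κ → ℤ) : ∑ k, m k • C.β k ∈ C.sub := by
  intro k
  exact ⟨m k, by rw [crd_sum_β]⟩

/-- The half-open cone with the facets in `S` removed. -/
def HalfOpen (S : Set κ) (x : M) : Prop :=
  ∀ k, 0 ≤ C.crd x k ∧ (k ∈ S → 0 < C.crd x k)

open Classical in
theorem halfOpen_iff (S : Set κ) (x : M) :
    C.HalfOpen S x ↔ ∀ k, 0 ≤ hfloor (k ∈ S) (C.crd x k) := by
  refine forall_congr' fun k => ?_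
  rw [hfloor_nonneg_iff]
  split_ifs with h
  · exact ⟨fun h' => h'.2 h, fun h' => ⟨h'.le, fun _ => h'⟩⟩
  · exact ⟨fun h' => h'.1, fun h' => ⟨h', fun h'' => absurd h'' h⟩⟩

open Classical in
theorem halfOpen_decomp_bijective (S : Set κ) (n : ℕ) :
    Function.Bijective (fun x : {x : M // C.HalfOpen S x ∧ C.ht x = n} =>
      (⟨(x.1 : C.Q), ⟨fun k => (hfloor (k ∈ S) (C.crd x.1 k)).toNat, by
        have h1 := (C.halfOpen_iff S x.1).1 x.2.1
        have h2 := C.qhgt_mk S x.1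
        rw [hgt, x.2.2] at h2
        zify
        simp only [Int.toNat_of_nonneg (h1 _)]
        linarith⟩⟩ :
        Σ q : C.Q, {m : κ → ℕ // ∑ k, m k + C.qhgt S q = n})) := by
  constructor
  · rintro ⟨x, hx⟩ ⟨y, hy⟩ hxy
    simp only [Sigma.mk.injEq] at hxy
    obtain ⟨h1, h2⟩ := hxy
    have hh : ∀ k, hfloor (k ∈ S) (C.crd x k) = hfloor (k ∈ S) (C.crd y k) := by
      intro k
      have h3 : (fun k => (hfloor (k ∈ S) (C.crd x k)).toNat) =
          fun k => (hfloor (k ∈ S) (C.crd y k)).toNat := by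
        have : ∀ (q q' : C.Q) (e : q = q') (f : {m : κ → ℕ // ∑ k, m k + C.qhgt S q = n})
          (g : {m : κ → ℕ // ∑ k, m k + C.qhgt S q' = n}), HEq f g → f.1 = g.1 := by
          rintro q _ rfl f g hfg
          rw [eq_of_heq hfg]
        exact this _ _ h1 _ _ h2
      have := congrFun h3 k
      have a := (C.halfOpen_iff S x).1 hx.1 k
      have b := (C.halfOpen_iff S y).1 hy.1 k
      omega
    have hm := (QuotientAddGroup.eq).1 h1
    ext
    change x = y
    apply C.crd_injective
    ext k
    obtain ⟨z, hz⟩ := hm k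
    have h4 : C.crd y k = C.crd x k + z := by
      simp only [map_add, map_neg, Pi.add_apply, Pi.neg_apply] at hz
      linarith
    have h5 := hh k
    rw [h4, hfloor_add_int] at h5
    have : z = 0 := by omega
    rw [h4, this]; simp
  · rintro ⟨q, m, hm⟩
    induction q using QuotientAddGroup.induction_on with
    | _ x0 =>
    set t : κ → ℤ := fun k => m k - hfloor (k ∈ S) (C.crd x0 k) with ht
    set x := x0 + ∑ k, t k • C.β k with hx
    have hc : ∀ k, hfloor (k ∈ S) (C.crd x k) = m k := by
      intro k
      rw [hx, map_add, Pi.add_apply, crd_sum_β, hfloor_add_int, ht]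
      ring
    have hq : (x : C.Q) = x0 := by
      rw [QuotientAddGroup.eq]
      have : -x + x0 = -∑ k, t k • C.β k := by rw [hx]; abel
      rw [this]
      exact neg_mem (C.sum_β_mem t)
    have hn : C.ht x = n := by
      have h1 := C.qhgt_mk S x0
      rw [← C.hgt_congr S hq, hgt] at h1
      simp only [hc] at h1
      rw [← hm]
      push_cast
      linarith
    have hh : C.HalfOpen S x := (C.halfOpen_iff S x).2 fun k => by rw [hc]; positivity
    refine ⟨⟨x, hh, hn⟩, ?_⟩
    have : ∀ (q q' : C.Q) (e : q = q') (f : {m : κ → ℕ // ∑ k, m k + C.qhgt S q = n})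
        (g : {m : κ → ℕ // ∑ k, m k + C.qhgt S q' = n}), f.1 = g.1 →
        (⟨q, f⟩ : Σ q : C.Q, {m : κ → ℕ // ∑ k, m k + C.qhgt S q = n}) = ⟨q', g⟩ := by
      rintro q _ rfl f g hfg
      rw [Subtype.ext hfg]
    refine this _ _ hq _ _ ?_
    funext k
    simp [hc]

theorem finite_halfOpen [Finite C.Q] (S : Set κ) (n : ℕ) :
    Finite {x : M // C.HalfOpen S x ∧ C.ht x = n} := by
  have := fun q : C.Q => finite_sum_add_eq (κ := κ) (C.qhgt S q) n
  exact Finite.of_injective _ (C.halfOpen_decomp_bijective S n).1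

theorem card_halfOpen [Fintype C.Q] (S : Set κ) (n : ℕ) :
    Nat.card {x : M // C.HalfOpen S x ∧ C.ht x = n} =
      ∑ q : C.Q, Nat.card {m : κ → ℕ // ∑ k, m k + C.qhgt S q = n} := by
  have := fun q : C.Q => finite_sum_add_eq (κ := κ) (C.qhgt S q) n
  rw [Nat.card_eq_of_bijective _ (C.halfOpen_decomp_bijective S n), Nat.card_sigma]

theorem series_halfOpen [Fintype C.Q] (S : Set κ) :
    (1 - PowerSeries.X : PowerSeries ℤ) ^ Fintype.card κ *
      PowerSeries.mk (fun n => (Nat.card {x : M // C.HalfOpen S x ∧ C.ht x = n} : ℤ)) =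
      ∑ q : C.Q, PowerSeries.X ^ C.qhgt S q := by
  have : PowerSeries.mk (fun n => (Nat.card {x : M // C.HalfOpen S x ∧ C.ht x = n} : ℤ)) =
      ∑ q : C.Q, PowerSeries.mk
        (fun n => (Nat.card {m : κ → ℕ // ∑ k, m k + C.qhgt S q = n} : ℤ)) := by
    ext n
    simp [C.card_halfOpen S n]
  rw [this, Finset.mul_sum]
  exact Finset.sum_congr rfl fun q _ => one_sub_X_pow_mul_mk_card_shift _

end SimplicialCone

/-- Membership in the cone spanned by a finite family. -/
def InCone {ι E : Type} [Fintype ι] [AddCommGroup E] [Module ℝ E] (w : ι → E) (x : E) : Prop :=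
  ∃ c : ι → ℝ, (∀ i, 0 ≤ c i) ∧ ∑ i, c i • w i = x

/-- The subfamily indexed by `B` is a basis. -/
structure IsBase {ι E : Type} [AddCommGroup E] [Module ℝ E] (w : ι → E) (B : Set ι) : Prop where
  indep : LinearIndepOn ℝ w B
  span_eq : Submodule.span ℝ (w '' B) = ⊤

namespace IsBase

section Coordinates

variable {ι E : Type} [Fintype ι] [AddCommGroup E] [Module ℝ E] {w : ι → E} {B : Set ι}

/-- The basis given by `IsBase`. -/
def basis (hB : IsBase w B) : Module.Basis B ℝ E :=
  Module.Basis.mk (v := fun i : B => w i) hB.indep (by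
    rw [← hB.span_eq]
    apply Submodule.span_mono
    rintro _ ⟨i, hi, rfl⟩
    exact ⟨⟨i, hi⟩, rfl⟩)

omit [Fintype ι] in
theorem basis_apply (hB : IsBase w B) (i : B) : hB.basis i = w i :=
  Module.Basis.mk_apply (v := fun i : B => w i) hB.indep _ i

open Classical in
/-- Coordinates with respect to a base, extended by zero. -/
def coords (hB : IsBase w B) : E →ₗ[ℝ] (ι → ℝ) :=
  LinearMap.pi fun i => if h : i ∈ B then hB.basis.coord ⟨i, h⟩ else 0

omit [Fintype ι] in
theorem coords_of_notMem (hB : IsBase w B) (x : E) {i : ι} (hi : i ∉ B) : hB.coords x i = 0 := by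
  simp [coords, hi]

omit [Fintype ι] in
theorem coords_coe (hB : IsBase w B) (x : E) (i : B) : hB.coords x i = hB.basis.repr x i := by
  simp [coords]

theorem sum_coords (hB : IsBase w B) (x : E) : ∑ i, hB.coords x i • w i = x := by
  classical
  conv_rhs => rw [← hB.basis.sum_repr x]
  rw [← Finset.sum_subset (Finset.subset_univ (Set.toFinset B))]
  · rw [← Finset.sum_subtype_of_mem (p := (· ∈ B)) (fun i => hB.coords x i • w i) (by simp)]
    refine Finset.sum_congr (by ext; simp) fun i _ => ?_
    rw [hB.basis_apply, ← hB.coords_coe]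
  · intro i _ hi
    rw [hB.coords_of_notMem x (by simpa using hi), zero_smul]

theorem coords_unique (hB : IsBase w B) {x : E} {c : ι → ℝ} (hc : ∀ i, i ∉ B → c i = 0)
    (hx : ∑ i, c i • w i = x) : hB.coords x = c := by
  classical
  have h0 : ∑ i, (c i - hB.coords x i) • w i = 0 := by
    simp only [sub_smul, Finset.sum_sub_distrib, hx, hB.sum_coords, sub_self]
  have h1 := (linearIndepOn_iff'.1 hB.indep) (Set.toFinset B) (fun i => c i - hB.coords x i)
    (by simp) (by
      rw [← h0]
      refine Finset.sum_subset (Finset.subset_univ _) fun i _ hi => ?_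
      have hi' : i ∉ B := by simpa using hi
      rw [hc i hi', hB.coords_of_notMem x hi', sub_zero, zero_smul])
  ext i
  by_cases hi : i ∈ B
  · have := h1 i (by simpa using hi)
    linarith
  · rw [hc i hi, hB.coords_of_notMem x hi]

theorem coords_self (hB : IsBase w B) {i : ι} (hi : i ∈ B) [DecidableEq ι] :
    hB.coords (w i) = Pi.single i 1 := by
  refine hB.coords_unique (fun j hj => ?_) ?_
  · rw [Pi.single_apply, if_neg]
    rintro rfl; exact hj hi
  · simp [Pi.single_apply]

open Classical in
/-- The linear relation expressing `w i` through the base. -/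
def rel (hB : IsBase w B) (i : ι) : ι → ℝ := Pi.single i 1 - hB.coords (w i)

theorem sum_rel (hB : IsBase w B) (i : ι) : ∑ j, hB.rel i j • w j = 0 := by
  classical
  simp only [rel, Pi.sub_apply, sub_smul, Finset.sum_sub_distrib, hB.sum_coords]
  simp [Pi.single_apply]

omit [Fintype ι] in
theorem rel_self (hB : IsBase w B) {i : ι} (hi : i ∉ B) : hB.rel i i = 1 := by
  simp [rel, hB.coords_of_notMem _ hi]

omit [Fintype ι] in
theorem rel_of_notMem (hB : IsBase w B) {i j : ι} (hj : j ∉ B) (hij : j ≠ i) :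
    hB.rel i j = 0 := by
  simp [rel, hB.coords_of_notMem _ hj, hij]

end Coordinates

section Optimal

variable {ι E : Type} [Fintype ι] [AddCommGroup E] [Module ℝ E] {w : ι → E}
  {B B' : Set ι}

/-- The base is the unique optimum of the linear programs with objective `ω`. -/
def Optimal (hB : IsBase w B) (ω : Module.Dual ℝ (ι → ℝ)) : Prop :=
  ∀ i, i ∉ B → 0 < ω (hB.rel i)

open Classical in
theorem sub_eq_sum_rel (hB : IsBase w B) (c : ι → ℝ) {x : E} (hc : ∑ i, c i • w i = x) :
    c = hB.coords x + ∑ i, (if i ∈ B then 0 else c i) • hB.rel i := by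
  rw [← sub_eq_iff_eq_add, eq_comm]
  refine hB.coords_unique (fun j hj => ?_) ?_
  · rw [Pi.sub_apply, Finset.sum_apply, Finset.sum_eq_single j]
    · simp [hj, hB.rel_self hj]
    · intro i _ hij
      rw [Pi.smul_apply, hB.rel_of_notMem hj hij.symm, smul_zero]
    · simp
  · have : ∑ j, (∑ i, (if i ∈ B then 0 else c i) • hB.rel i) j • w j = 0 := by
      simp only [Finset.sum_apply, Pi.smul_apply, Finset.sum_smul, smul_eq_mul, mul_smul]
      rw [Finset.sum_comm]
      refine Finset.sum_eq_zero fun i _ => ?_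
      rw [← Finset.smul_sum, hB.sum_rel, smul_zero]
    simp only [Pi.sub_apply, sub_smul, Finset.sum_sub_distrib, hc, this, sub_zero]

theorem Optimal.le (hB : IsBase w B) {ω : Module.Dual ℝ (ι → ℝ)} (h : hB.Optimal ω)
    {c : ι → ℝ} (hc0 : ∀ i, 0 ≤ c i) {x : E} (hc : ∑ i, c i • w i = x) :
    ω (hB.coords x) ≤ ω c := by
  classical
  conv_rhs => rw [hB.sub_eq_sum_rel c hc]
  rw [map_add, map_sum]
  refine le_add_of_nonneg_right (Finset.sum_nonneg fun i _ => ?_)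
  rw [map_smul, smul_eq_mul]
  split_ifs with hi
  · simp
  · exact mul_nonneg (hc0 i) (h i hi).le

theorem Optimal.lt (hB : IsBase w B) {ω : Module.Dual ℝ (ι → ℝ)} (h : hB.Optimal ω)
    {c : ι → ℝ} (hc0 : ∀ i, 0 ≤ c i) {x : E} (hc : ∑ i, c i • w i = x) {i : ι} (hi : i ∉ B)
    (hci : 0 < c i) : ω (hB.coords x) < ω c := by
  classical
  conv_rhs => rw [hB.sub_eq_sum_rel c hc]
  rw [map_add, map_sum]
  refine lt_add_of_pos_right _ (Finset.sum_pos' (fun j _ => ?_) ⟨i, Finset.mem_univ i, ?_⟩)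
  · rw [map_smul, smul_eq_mul]
    split_ifs with hj
    · simp
    · exact mul_nonneg (hc0 j) (h j hj).le
  · rw [map_smul, smul_eq_mul, if_neg hi]
    exact mul_pos hci (h i hi)

theorem Optimal.unique (hB : IsBase w B) (hB' : IsBase w B') {ω : Module.Dual ℝ (ι → ℝ)}
    (h : hB.Optimal ω) (h' : hB'.Optimal ω) {x : E} (hx : ∀ i ∈ B, 0 < hB.coords x i)
    (hx' : ∀ i ∈ B', 0 < hB'.coords x i) : B = B' := by
  have key : ∀ {B B' : Set ι} (hB : IsBase w B) (hB' : IsBase w B'), hB.Optimal ω →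
      hB'.Optimal ω → (∀ i ∈ B, 0 < hB.coords x i) → (∀ i ∈ B', 0 < hB'.coords x i) →
      B ⊆ B' := by
    intro B B' hB hB' h h' hx hx' i hi
    by_contra hi'
    have nn : ∀ {B : Set ι} (hB : IsBase w B), (∀ i ∈ B, 0 < hB.coords x i) →
        ∀ i, 0 ≤ hB.coords x i := by
      intro B hB hx i
      by_cases hi : i ∈ B
      · exact (hx i hi).le
      · rw [hB.coords_of_notMem x hi]
    have h1 := Optimal.lt hB' h' (nn hB hx) (hB.sum_coords x) hi' (hx i hi)
    have h2 := Optimal.le hB h (nn hB' hx') (hB'.sum_coords x)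
    linarith
  exact (key hB hB' h h' hx hx').antisymm (key hB' hB h' h hx' hx)

theorem exists_pos_add_smul_nonneg (c r : ι → ℝ) (hc : ∀ i, 0 ≤ c i)
    (hr : ∀ i, r i < 0 → 0 < c i) : ∃ δ : ℝ, 0 < δ ∧ ∀ i, 0 ≤ (c + δ • r) i := by
  have h : ∀ᶠ δ : ℝ in nhdsWithin 0 (Set.Ioi 0), ∀ i, 0 ≤ (c + δ • r) i := by
    rw [Filter.eventually_all]
    intro i
    by_cases hi : r i < 0
    · have h0 : Filter.Tendsto (fun δ : ℝ => (c + δ • r) i) (nhdsWithin 0 (Set.Ioi 0))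
          (nhds (c i)) := by
        have : Continuous (fun δ : ℝ => (c + δ • r) i) := by
          simp only [Pi.add_apply, Pi.smul_apply, smul_eq_mul]; fun_prop
        have h2 := (this.tendsto 0).mono_left (nhdsWithin_le_nhds (s := Set.Ioi 0))
        simpa using h2
      filter_upwards [h0.eventually (lt_mem_nhds (hr i hi))] with δ hδ using hδ.le
    · filter_upwards [self_mem_nhdsWithin] with δ hδ
      have hδ' : (0 : ℝ) < δ := hδ
      simp only [Pi.add_apply, Pi.smul_apply, smul_eq_mul]
      have := mul_nonneg hδ'.le (not_lt.1 hi)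
      linarith [hc i]
  obtain ⟨δ, h1, h2⟩ := (h.and self_mem_nhdsWithin).exists
  exact ⟨δ, h2, h1⟩

end Optimal

end IsBase

section Existence

variable {ι E : Type} [Fintype ι] [AddCommGroup E] [Module ℝ E] {w : ι → E}

/-- An objective for which no linear program over the bases is degenerate. -/
def GenericObjective (w : ι → E) (ω : Module.Dual ℝ (ι → ℝ)) : Prop :=
  ∀ (B : Set ι) (hB : IsBase w B) (i : ι), i ∉ B → ω (hB.rel i) ≠ 0

/-- A vector lying on no hyperplane spanned by members of the family. -/
def GenericVector (w : ι → E) (y : E) : Prop :=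
  ∀ (B : Set ι) (hB : IsBase w B) (i : ι), i ∈ B → hB.coords y i ≠ 0

theorem exists_base_subset_support (hw : Submodule.span ℝ (Set.range w) = ⊤) {x : E}
    (hx : GenericVector w x) {c : ι → ℝ} (hc : ∑ i, c i • w i = x) :
    ∃ B, IsBase w B ∧ ∀ i ∈ B, c i ≠ 0 := by
  obtain ⟨t, hts, -, ht2, ht3⟩ := exists_linearIndepOn_extension (K := ℝ) (v := w)
    (s := ∅) (t := {i | c i ≠ 0}) (linearIndepOn_empty ℝ w) (Set.empty_subset _)
  obtain ⟨B, -, htB, hB2, hB3⟩ := exists_linearIndepOn_extension (K := ℝ) (v := w)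
    ht3 (Set.subset_univ t)
  have hB : IsBase w B := by
    refine ⟨hB3, top_le_iff.1 ?_⟩
    rw [← hw, Submodule.span_le, ← Set.image_univ]
    exact hB2
  have hxt : x ∈ Submodule.span ℝ (w '' t) := by
    rw [← hc]
    refine Submodule.sum_mem _ fun i _ => ?_
    by_cases hi : c i = 0
    · simp [hi]
    · exact Submodule.smul_mem _ _ (ht2 ⟨i, hi, rfl⟩)
  refine ⟨B, hB, fun i hi => hts ?_⟩
  by_contra hit
  refine hx B hB i hi ?_
  have hle : Submodule.span ℝ (w '' t) ≤ LinearMap.ker (LinearMap.proj i ∘ₗ hB.coords) := by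
    classical
    rw [Submodule.span_le]
    rintro _ ⟨j, hj, rfl⟩
    simp only [SetLike.mem_coe, LinearMap.mem_ker, LinearMap.comp_apply, LinearMap.proj_apply]
    rw [hB.coords_self (htB hj), Pi.single_apply, if_neg]
    rintro rfl; exact hit hj
  exact hle hxt

theorem exists_optimal (hw : Submodule.span ℝ (Set.range w) = ⊤) (ℓ : E →ₗ[ℝ] ℝ)
    (hℓ : ∀ i, ℓ (w i) = 1) {ω : Module.Dual ℝ (ι → ℝ)} (hω : GenericObjective w ω) {x : E}
    (hx : GenericVector w x) (hxC : InCone w x) :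
    ∃ B, ∃ hB : IsBase w B, hB.Optimal ω ∧ ∀ i ∈ B, 0 < hB.coords x i := by
  classical
  set L : (ι → ℝ) →ₗ[ℝ] E := Fintype.linearCombination ℝ w with hL
  have hLa : ∀ c, L c = ∑ i, c i • w i := fun c => by simp [hL, Fintype.linearCombination_apply]
  obtain ⟨c0, hc0, hc0x⟩ := hxC
  set K : Set (ι → ℝ) := {c | (∀ i, 0 ≤ c i) ∧ L c = x} with hK
  have hsum : ∀ c ∈ K, ∑ i, c i = ℓ x := by
    intro c hc
    rw [← hc.2, hLa, map_sum]
    simp [hℓ]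
  have hKclosed : IsClosed K := by
    have h1 : IsClosed {c : ι → ℝ | ∀ i, 0 ≤ c i} := by
      simp only [Set.ofPred_forall]
      exact isClosed_iInter fun i => isClosed_le continuous_const (continuous_apply i)
    have h2 : IsClosed {c : ι → ℝ | L c = x} := by
      have h3 : {c : ι → ℝ | L c = x} = (fun c => c - c0) ⁻¹' (LinearMap.ker L : Set (ι → ℝ)) := by
        ext c
        simp only [Set.mem_ofPred_eq, Set.mem_preimage, SetLike.mem_coe, LinearMap.mem_ker,
          map_sub, sub_eq_zero]
        rw [hLa c0, hc0x]
      rw [h3]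
      exact (Submodule.closed_of_finiteDimensional _).preimage (by fun_prop)
    exact h1.inter h2
  have hKcompact : IsCompact K := by
    refine (isCompact_Icc (a := (0 : ι → ℝ)) (b := fun _ => ℓ x)).of_isClosed_subset hKclosed ?_
    intro c hc
    refine ⟨fun i => hc.1 i, fun i => ?_⟩
    rw [← hsum c hc]
    exact Finset.single_le_sum (fun j _ => hc.1 j) (Finset.mem_univ i)
  obtain ⟨c, hcK, hcmin⟩ := hKcompact.exists_isMinOn ⟨c0, hc0, by rw [hLa, hc0x]⟩
    (LinearMap.continuous_of_finiteDimensional ω).continuousOn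
  have hcx : ∑ i, c i • w i = x := by rw [← hLa]; exact hcK.2
  obtain ⟨B, hB, hBc⟩ := exists_base_subset_support hw hx hcx
  have hBpos : ∀ i ∈ B, 0 < c i := fun i hi => lt_of_le_of_ne (hcK.1 i) (hBc i hi).symm
  have hmove : ∀ r : ι → ℝ, L r = 0 → (∀ i, r i < 0 → 0 < c i) → 0 ≤ ω r := by
    intro r hr hrc
    obtain ⟨δ, hδ, hδ'⟩ := IsBase.exists_pos_add_smul_nonneg c r hcK.1 hrc
    have h1 : ω c ≤ ω (c + δ • r) := hcmin ⟨hδ', by rw [map_add, map_smul, hr, hcK.2]; simp⟩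
    rw [map_add, map_smul, smul_eq_mul] at h1
    nlinarith
  have hrel : ∀ i, L (hB.rel i) = 0 := fun i => by rw [hLa, hB.sum_rel]
  have hpos : ∀ i, i ∉ B → 0 < ω (hB.rel i) := by
    intro i hi
    refine lt_of_le_of_ne (hmove _ (hrel i) fun j hj => ?_) (hω B hB i hi).symm
    by_cases hjB : j ∈ B
    · exact hBpos j hjB
    · by_cases hij : j = i
      · subst hij; rw [hB.rel_self hjB] at hj; linarith
      · rw [hB.rel_of_notMem hjB hij] at hj; linarith
  have hsupp : ∀ i, i ∉ B → c i = 0 := by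
    intro i hi
    by_contra hci
    have := hmove (-hB.rel i) (by rw [map_neg, hrel, neg_zero]) fun j hj => ?_
    · rw [map_neg] at this
      linarith [hpos i hi]
    · by_cases hjB : j ∈ B
      · exact hBpos j hjB
      · by_cases hij : j = i
        · subst hij; exact lt_of_le_of_ne (hcK.1 j) (Ne.symm hci)
        · rw [Pi.neg_apply, hB.rel_of_notMem hjB hij] at hj; linarith
  refine ⟨B, hB, hpos, fun i hi => ?_⟩
  rw [hB.coords_unique hsupp hcx]
  exact hBpos i hi

theorem eventually_pos_iff (a : ℝ) {b : ℝ} (hb : b ≠ 0) :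
    ∀ᶠ ε : ℝ in nhdsWithin 0 (Set.Ioi 0),
      a + ε * b ≠ 0 ∧ (0 < a + ε * b ↔ 0 ≤ a ∧ (b < 0 → 0 < a)) := by
  have h0 : Filter.Tendsto (fun ε : ℝ => a + ε * b) (nhdsWithin 0 (Set.Ioi 0)) (nhds a) := by
    have : Continuous (fun ε : ℝ => a + ε * b) := by fun_prop
    have h2 := (this.tendsto 0).mono_left (nhdsWithin_le_nhds (s := Set.Ioi 0))
    simpa using h2
  rcases lt_trichotomy a 0 with ha | ha | ha
  · filter_upwards [h0.eventually (gt_mem_nhds ha)] with ε hε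
    exact ⟨hε.ne, ⟨fun h => by linarith, fun h => by linarith [h.1]⟩⟩
  · subst ha
    filter_upwards [self_mem_nhdsWithin] with ε hε
    have hε' : (0 : ℝ) < ε := hε
    simp only [zero_add, le_refl, true_and, lt_irrefl, imp_false, not_lt]
    refine ⟨mul_ne_zero hε'.ne' hb, ?_⟩
    rw [mul_pos_iff_of_pos_left hε']
    exact le_iff_lt_or_eq.trans (by simp [hb.symm]) |>.symm
  · filter_upwards [h0.eventually (lt_mem_nhds ha)] with ε hε
    exact ⟨hε.ne', ⟨fun h => ⟨ha.le, fun _ => ha⟩, fun _ => hε⟩⟩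

/-- The cone over the base `B` without the facets not visible in direction `y`. -/
def IsBase.InHalfOpen {B : Set ι} (hB : IsBase w B) (y x : E) : Prop :=
  ∀ i ∈ B, 0 ≤ hB.coords x i ∧ (hB.coords y i < 0 → 0 < hB.coords x i)

theorem eventually_inHalfOpen_iff {y : E} (hy : GenericVector w y) (x : E) :
    ∀ᶠ ε : ℝ in nhdsWithin 0 (Set.Ioi 0), GenericVector w (x + ε • y) ∧
      ∀ (B : Set ι) (hB : IsBase w B),
        (hB.InHalfOpen y x ↔ ∀ i ∈ B, 0 < hB.coords (x + ε • y) i) := by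
  have h : ∀ᶠ ε : ℝ in nhdsWithin 0 (Set.Ioi 0), ∀ (B : Set ι) (hB : IsBase w B) (i : ι),
      i ∈ B → hB.coords x i + ε * hB.coords y i ≠ 0 ∧ (0 < hB.coords x i + ε * hB.coords y i ↔
        0 ≤ hB.coords x i ∧ (hB.coords y i < 0 → 0 < hB.coords x i)) := by
    rw [Filter.eventually_all]
    intro B
    by_cases hB : IsBase w B
    · have : ∀ᶠ ε : ℝ in nhdsWithin 0 (Set.Ioi 0), ∀ (i : ι),
        i ∈ B → hB.coords x i + ε * hB.coords y i ≠ 0 ∧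
        (0 < hB.coords x i + ε * hB.coords y i ↔
        0 ≤ hB.coords x i ∧ (hB.coords y i < 0 → 0 < hB.coords x i)) := by
        rw [Filter.eventually_all]
        intro i
        by_cases hi : i ∈ B
        · filter_upwards [eventually_pos_iff (hB.coords x i) (hy B hB i hi)] with ε hε _ using hε
        · exact Filter.Eventually.of_forall fun _ h => absurd h hi
      filter_upwards [this] with ε hε _ using hε
    · exact Filter.Eventually.of_forall fun _ h => absurd h hB
  filter_upwards [h] with ε hε
  refine ⟨fun B hB i hi => ?_, fun B hB => forall₂_congr fun i hi => ?_⟩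
  · simpa using (hε B hB i hi).1
  · simpa using (hε B hB i hi).2.symm

/-- The points of the cone that stay in the cone when moved slightly in direction `y`. -/
def ConeToward (w : ι → E) (y x : E) : Prop :=
  ∀ᶠ ε : ℝ in nhdsWithin 0 (Set.Ioi 0), InCone w (x + ε • y)

theorem coneToward_iff_existsUnique (hw : Submodule.span ℝ (Set.range w) = ⊤) (ℓ : E →ₗ[ℝ] ℝ)
    (hℓ : ∀ i, ℓ (w i) = 1) {ω : Module.Dual ℝ (ι → ℝ)} (hω : GenericObjective w ω) {y : E}
    (hy : GenericVector w y) (x : E) :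
    ConeToward w y x ↔ ∃ B, ∃ hB : IsBase w B, hB.Optimal ω ∧ hB.InHalfOpen y x := by
  constructor
  · intro h
    obtain ⟨ε, h1, h2, h3⟩ := (h.and (eventually_inHalfOpen_iff hy x)).exists
    obtain ⟨B, hB, hBo, hBx⟩ := exists_optimal hw ℓ hℓ hω h2 h1
    exact ⟨B, hB, hBo, (h3 B hB).2 hBx⟩
  · rintro ⟨B, hB, -, hBx⟩
    filter_upwards [eventually_inHalfOpen_iff hy x] with ε hε
    refine ⟨hB.coords (x + ε • y), fun i => ?_, hB.sum_coords _⟩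
    by_cases hi : i ∈ B
    · exact ((hε.2 B hB).1 hBx i hi).le
    · rw [hB.coords_of_notMem _ hi]

theorem inHalfOpen_unique {ω : Module.Dual ℝ (ι → ℝ)} {y : E}
    (hy : GenericVector w y) {x : E} {B B' : Set ι} (hB : IsBase w B) (hB' : IsBase w B')
    (h : hB.Optimal ω) (h' : hB'.Optimal ω) (hx : hB.InHalfOpen y x)
    (hx' : hB'.InHalfOpen y x) : B = B' := by
  obtain ⟨ε, -, h3⟩ := (eventually_inHalfOpen_iff hy x).exists
  exact IsBase.Optimal.unique hB hB' h h' ((h3 B hB).1 hx) ((h3 B' hB').1 hx')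

theorem exists_genericObjective (w : ι → E) : ∃ ω, GenericObjective w ω := by
  obtain ⟨ω, hω⟩ := Module.exists_dual_forall_apply_ne_zero (K := ℝ) (M := ι → ℝ)
    (ι := {p : Set ι × ι // ∃ _ : IsBase w p.1, p.2 ∉ p.1})
    (fun p => p.2.choose.rel p.1.2) (by
      rintro ⟨⟨B, i⟩, hB, hi⟩ h0
      have h1 := congrFun h0 i
      rw [IsBase.rel_self _ hi] at h1
      simp at h1)
  exact ⟨ω, fun B hB i hi => hω ⟨(B, i), hB, hi⟩⟩

omit [Fintype ι] in
theorem GenericVector.neg {y : E} (hy : GenericVector w y) : GenericVector w (-y) := by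
  intro B hB i hi
  rw [map_neg, Pi.neg_apply, neg_ne_zero]
  exact hy B hB i hi

theorem exists_genericVector (w : ι → E) : ∃ c : ι → ℝ, (∀ i, 0 < c i) ∧
    GenericVector w (∑ i, c i • w i) := by
  classical
  obtain ⟨z, hz⟩ := Module.Dual.exists_forall_ne_zero_of_forall_exists (K := ℝ)
    (M := ι → ℝ) (ι := {p : Set ι × ι // ∃ _ : IsBase w p.1, p.2 ∈ p.1})
    (fun p => LinearMap.proj p.1.2 ∘ₗ p.2.choose.coords ∘ₗ Fintype.linearCombination ℝ w) (by
      rintro ⟨⟨B, i⟩, hB, hi⟩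
      refine ⟨Pi.single i 1, ?_⟩
      simp only [LinearMap.comp_apply, Fintype.linearCombination_apply_single, one_smul,
        LinearMap.proj_apply]
      rw [IsBase.coords_self _ hi]
      simp)
  have hz' : ∀ (B : Set ι) (hB : IsBase w B) (i : ι), i ∈ B →
      hB.coords (∑ j, z j • w j) i ≠ 0 := by
    intro B hB i hi
    have := hz ⟨(B, i), hB, hi⟩
    simpa [Fintype.linearCombination_apply] using this
  have h1 := (eventually_inHalfOpen_iff (y := ∑ j, z j • w j) hz' (∑ i, w i))
  have h2 : ∀ᶠ ε : ℝ in nhdsWithin 0 (Set.Ioi 0), ∀ i, 0 < 1 + ε * z i := by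
    rw [Filter.eventually_all]
    intro i
    by_cases hzi : z i = 0
    · exact Filter.Eventually.of_forall fun ε => by simp [hzi]
    · filter_upwards [eventually_pos_iff 1 hzi] with ε hε
      exact hε.2.2 ⟨zero_le_one, fun _ => zero_lt_one⟩
  obtain ⟨ε, hε1, hε2⟩ := (h1.and h2).exists
  refine ⟨fun i => 1 + ε * z i, hε2, ?_⟩
  have : ∑ i, (1 + ε * z i) • w i = ∑ i, w i + ε • ∑ j, z j • w j := by
    simp only [add_smul, one_smul, Finset.sum_add_distrib, mul_smul, Finset.smul_sum]
  rw [this]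
  exact hε1.1

end Existence

/-- The real vector with the given integer coordinates. -/
def castVec {n : ℕ} : (Fin n → ℤ) →+ (Fin n → ℝ) := (Int.castAddHom ℝ).compLeft (Fin n)

@[simp] theorem castVec_apply {n : ℕ} (x : Fin n → ℤ) (j : Fin n) : castVec x j = x j := rfl

theorem castVec_injective {n : ℕ} : Function.Injective (castVec (n := n)) := by
  intro x y h
  ext j
  have := congrFun h j
  simpa using this

/-- The simplicial cone over a basis of lattice vectors at height one. -/
def SimplicialCone.ofBasis {n : ℕ} {κ : Type} [Fintype κ] [DecidableEq κ]
    (b : Module.Basis κ ℝ (Fin n → ℝ)) (β : κ → Fin n → ℤ) (hb : ∀ k, b k = castVec (β k))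
    (l : Fin n) (hl : ∀ k, β k l = 1) : SimplicialCone (Fin n → ℤ) κ where
  crd := b.equivFun.toLinearMap.toAddMonoidHom.comp castVec
  crd_injective := b.equivFun.injective.comp castVec_injective
  β := β
  crd_β := fun k => by
    change b.equivFun (castVec (β k)) = _
    rw [← hb, Module.Basis.equivFun_apply, Module.Basis.repr_self]
    ext j
    rw [Finsupp.single_apply, Pi.single_apply]
    simp [eq_comm]
  ht := Pi.evalAddMonoidHom (fun _ => ℤ) l
  sum_crd := fun x => by
    have h := congrFun (b.sum_equivFun (castVec x)) l
    rw [Finset.sum_apply] at h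
    simp only [Pi.smul_apply, hb, castVec_apply, hl, smul_eq_mul, Int.cast_one, mul_one] at h
    exact h

theorem SimplicialCone.ofBasis_crd {n : ℕ} {κ : Type} [Fintype κ] [DecidableEq κ]
    (b : Module.Basis κ ℝ (Fin n → ℝ)) (β : κ → Fin n → ℤ) (hb : ∀ k, b k = castVec (β k))
    (l : Fin n) (hl : ∀ k, β k l = 1) (x : Fin n → ℤ) (k : κ) :
    (SimplicialCone.ofBasis b β hb l hl).crd x k = b.repr (castVec x) k := rfl

theorem SimplicialCone.sum_crd_smul {n : ℕ} {κ : Type} [Fintype κ] [DecidableEq κ]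
    (C : SimplicialCone (Fin n → ℤ) κ) (b : Module.Basis κ ℝ (Fin n → ℝ))
    (hC : ∀ x k, C.crd x k = b.repr (castVec x) k) (x : Fin n → ℤ) :
    ∑ k, C.crd x k • b k = castVec x := by
  simp only [hC]
  exact b.sum_repr _

theorem SimplicialCone.finite_Q_ofBasis {n : ℕ} {κ : Type} [Fintype κ] [DecidableEq κ]
    (b : Module.Basis κ ℝ (Fin n → ℝ)) (β : κ → Fin n → ℤ) (hb : ∀ k, b k = castVec (β k))
    (l : Fin n) (hl : ∀ k, β k l = 1) : Finite (SimplicialCone.ofBasis b β hb l hl).Q := by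
  set C := SimplicialCone.ofBasis b β hb l hl with hC
  set K : Fin n → ℤ := fun j => ∑ k, |β k j| with hK
  have hfin : (Set.Icc (-K) K).Finite := Set.finite_Icc _ _
  have := hfin.to_subtype
  refine Finite.of_surjective (fun x : Set.Icc (-K) K => ((x : Fin n → ℤ) : C.Q)) ?_
  intro q
  induction q using QuotientAddGroup.induction_on with
  | _ x =>
  set m : κ → ℤ := fun k => - ⌊C.crd x k⌋ with hm
  set y := x + ∑ k, m k • C.β k with hy
  have hcy : ∀ k, C.crd y k = Int.fract (C.crd x k) := by
    intro k
    rw [hy, map_add, Pi.add_apply, C.crd_sum_β, hm, Int.fract]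
    push_cast
    ring
  have hyb : castVec y = ∑ k, C.crd y k • castVec (β k) := by
    rw [← C.sum_crd_smul b (fun _ _ => rfl)]
    simp only [hb]
  have hyK : ∀ j, |y j| ≤ K j := by
    intro j
    have h1 : (|y j| : ℝ) ≤ ∑ k, |(β k j : ℝ)| := by
      have h2 := congrFun hyb j
      rw [Finset.sum_apply] at h2
      simp only [castVec_apply, Pi.smul_apply, smul_eq_mul] at h2
      rw [h2]
      refine (Finset.abs_sum_le_sum_abs _ _).trans (Finset.sum_le_sum fun k _ => ?_)
      rw [abs_mul, hcy, abs_of_nonneg (Int.fract_nonneg _)]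
      exact mul_le_of_le_one_left (abs_nonneg _) (Int.fract_lt_one _).le
    rw [hK]
    exact_mod_cast h1
  refine ⟨⟨y, ⟨fun j => (abs_le.1 (hyK j)).1, fun j => (abs_le.1 (hyK j)).2⟩⟩, ?_⟩
  change (y : C.Q) = x
  rw [QuotientAddGroup.eq]
  have : -y + x = -∑ k, m k • C.β k := by rw [hy]; abel
  rw [this]
  exact neg_mem (C.sum_β_mem m)

section OptBase

variable {n : ℕ} {ι : Type} [Fintype ι]

/-- The bases of the family `W` that are optimal for the objective `ω`. -/
abbrev OptBase (W : ι → Fin n → ℤ) (ω : Module.Dual ℝ (ι → ℝ)) : Type :=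
  {B : Set ι // ∃ hB : IsBase (fun i => castVec (W i)) B, hB.Optimal ω}

variable {W : ι → Fin n → ℤ} {ω : Module.Dual ℝ (ι → ℝ)}

open Classical in
instance : Fintype (OptBase W ω) := Fintype.ofFinite _

open Classical in
instance (B : OptBase W ω) : Fintype B.1 := Fintype.ofFinite _

open Classical in
/-- The simplicial cone over an optimal base. -/
def OptBase.cone (B : OptBase W ω) (l : Fin n) (hl : ∀ i, W i l = 1) :
    SimplicialCone (Fin n → ℤ) B.1 :=
  SimplicialCone.ofBasis B.2.choose.basis (fun i => W i) (fun i => B.2.choose.basis_apply i) l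
    (fun i => hl i)

/-- The facets of the cone over an optimal base that are removed. -/
def OptBase.removed (B : OptBase W ω) (y : Fin n → ℝ) : Set B.1 :=
  {i | B.2.choose.coords y i < 0}

open Classical in
instance (B : OptBase W ω) (l : Fin n) (hl : ∀ i, W i l = 1) : Finite (B.cone l hl).Q :=
  SimplicialCone.finite_Q_ofBasis _ _ _ _ _

open Classical in
instance (B : OptBase W ω) (l : Fin n) (hl : ∀ i, W i l = 1) : Fintype (B.cone l hl).Q :=
  Fintype.ofFinite _

open Classical in
theorem OptBase.cone_crd (B : OptBase W ω) (l : Fin n) (hl : ∀ i, W i l = 1) (x : Fin n → ℤ)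
    (i : B.1) : (B.cone l hl).crd x i = B.2.choose.coords (castVec x) i :=
  (B.2.choose.coords_coe _ i).symm

open Classical in
theorem OptBase.halfOpen_iff (B : OptBase W ω) (l : Fin n) (hl : ∀ i, W i l = 1)
    (y : Fin n → ℝ) (x : Fin n → ℤ) : (B.cone l hl).HalfOpen (B.removed y) x ↔
      B.2.choose.InHalfOpen y (castVec x) := by
  unfold SimplicialCone.HalfOpen IsBase.InHalfOpen
  simp only [B.cone_crd]
  exact ⟨fun h i hi => h ⟨i, hi⟩, fun h i => h i.1 i.2⟩

open Classical in
theorem OptBase.card (B : OptBase W ω) : Fintype.card B.1 = n := by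
  rw [← Module.finrank_eq_card_basis B.2.choose.basis]
  simp

open Classical in
/-- The graded count of lattice points of a (half-open) cone over lattice points of height one. -/
theorem series_coneToward (l : Fin n) (hl : ∀ i, W i l = 1)
    (hw : Submodule.span ℝ (Set.range fun i => castVec (W i)) = ⊤)
    (hω : GenericObjective (fun i => castVec (W i)) ω) {y : Fin n → ℝ}
    (hy : GenericVector (fun i => castVec (W i)) y) :
    (1 - PowerSeries.X : PowerSeries ℤ) ^ n * PowerSeries.mk (fun m => (Nat.card
      {x : Fin n → ℤ // ConeToward (fun i => castVec (W i)) y (castVec x) ∧ x l = m} : ℤ)) =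
      ∑ θ : Σ B : OptBase W ω, (B.cone l hl).Q,
        PowerSeries.X ^ (θ.1.cone l hl).qhgt (θ.1.removed y) θ.2 := by
  have hcone := coneToward_iff_existsUnique hw (LinearMap.proj l) (by simp [hl]) hω hy
  have hbij : ∀ m : ℕ, Function.Bijective (fun p : Σ B : OptBase W ω,
      {x : Fin n → ℤ // (B.cone l hl).HalfOpen (B.removed y) x ∧ (B.cone l hl).ht x = m} =>
      (⟨p.2.1, (hcone _).2 ⟨_, p.1.2.choose, p.1.2.choose_spec,
        (p.1.halfOpen_iff l hl y _).1 p.2.2.1⟩, p.2.2.2⟩ :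
        {x : Fin n → ℤ // ConeToward (fun i => castVec (W i)) y (castVec x) ∧ x l = m})) := by
    intro m
    constructor
    · rintro ⟨B, x, hx⟩ ⟨B', x', hx'⟩ h
      have hxx : x = x' := congrArg Subtype.val h
      subst hxx
      have hBB : B = B' := Subtype.ext (inHalfOpen_unique hy B.2.choose B'.2.choose
        B.2.choose_spec B'.2.choose_spec ((B.halfOpen_iff l hl y x).1 hx.1)
        ((B'.halfOpen_iff l hl y x).1 hx'.1))
      subst hBB
      rfl
    · rintro ⟨x, hx, hxm⟩
      obtain ⟨B, hB, hBo, hBx⟩ := (hcone _).1 hx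
      set B' : OptBase W ω := ⟨B, hB, hBo⟩
      exact ⟨⟨B', x, (B'.halfOpen_iff l hl y x).2 hBx, hxm⟩, rfl⟩
  have hmk : PowerSeries.mk (fun m => (Nat.card
      {x : Fin n → ℤ // ConeToward (fun i => castVec (W i)) y (castVec x) ∧ x l = m} : ℤ)) =
      ∑ B : OptBase W ω, PowerSeries.mk (fun m => (Nat.card {x : Fin n → ℤ //
        (B.cone l hl).HalfOpen (B.removed y) x ∧ (B.cone l hl).ht x = m} : ℤ)) := by
    ext m
    have := fun B : OptBase W ω => (B.cone l hl).finite_halfOpen (B.removed y) m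
    rw [PowerSeries.coeff_mk, ← Nat.card_eq_of_bijective _ (hbij m), Nat.card_sigma]
    simp
  rw [hmk, Finset.mul_sum, Fintype.sum_sigma]
  refine Finset.sum_congr rfl fun B _ => ?_
  have h := (B.cone l hl).series_halfOpen (B.removed y)
  rw [B.card] at h
  exact h

theorem finite_coneToward (l : Fin n) (hl : ∀ i, W i l = 1)
    (hw : Submodule.span ℝ (Set.range fun i => castVec (W i)) = ⊤)
    (hω : GenericObjective (fun i => castVec (W i)) ω) {y : Fin n → ℝ}
    (hy : GenericVector (fun i => castVec (W i)) y) (m : ℕ) :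
    Finite {x : Fin n → ℤ // ConeToward (fun i => castVec (W i)) y (castVec x) ∧ x l = m} := by
  classical
  have hcone := coneToward_iff_existsUnique hw (LinearMap.proj l) (by simp [hl]) hω hy
  have := fun B : OptBase W ω => (B.cone l hl).finite_halfOpen (B.removed y) m
  refine Finite.of_surjective (fun p : Σ B : OptBase W ω,
      {x : Fin n → ℤ // (B.cone l hl).HalfOpen (B.removed y) x ∧ (B.cone l hl).ht x = m} =>
      (⟨p.2.1, (hcone _).2 ⟨_, p.1.2.choose, p.1.2.choose_spec,
        (p.1.halfOpen_iff l hl y _).1 p.2.2.1⟩, p.2.2.2⟩ :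
        {x : Fin n → ℤ // ConeToward (fun i => castVec (W i)) y (castVec x) ∧ x l = m})) ?_
  rintro ⟨x, hx, hxm⟩
  obtain ⟨B, hB, hBo, hBx⟩ := (hcone _).1 hx
  set B' : OptBase W ω := ⟨B, hB, hBo⟩
  exact ⟨⟨B', x, (B'.halfOpen_iff l hl y x).2 hBx, hxm⟩, rfl⟩

omit [Fintype ι] in
theorem OptBase.removed_neg (B : OptBase W ω) {y : Fin n → ℝ}
    (hy : GenericVector (fun i => castVec (W i)) y) : B.removed (-y) = (B.removed y)ᶜ := by
  ext i
  have := hy B.1 B.2.choose i.1 i.2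
  simp only [OptBase.removed, map_neg, Pi.neg_apply, Set.mem_ofPred_eq, Set.mem_compl_iff]
  constructor
  · intro h; linarith
  · intro h
    have := lt_of_le_of_ne (not_lt.1 h) this.symm
    linarith

theorem coneToward_of_pos {E : Type} [AddCommGroup E] [Module ℝ E] {w : ι → E} {c : ι → ℝ}
    (hc : ∀ i, 0 < c i) (x : E) (hx : InCone w x) : ConeToward w (∑ i, c i • w i) x := by
  filter_upwards [self_mem_nhdsWithin] with ε hε
  have hε' : (0 : ℝ) < ε := hε
  obtain ⟨a, ha, rfl⟩ := hx
  refine ⟨a + ε • c, fun i => ?_, ?_⟩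
  · have := mul_pos hε' (hc i)
    simp only [Pi.add_apply, Pi.smul_apply, smul_eq_mul]
    linarith [ha i]
  · simp [add_smul, Finset.sum_add_distrib, Finset.smul_sum, mul_smul]

theorem IsBase.InHalfOpen.inCone {E : Type} [AddCommGroup E] [Module ℝ E] {w : ι → E}
    {B : Set ι} {hB : IsBase w B} {y x : E} (h : hB.InHalfOpen y x) : InCone w x := by
  refine ⟨hB.coords x, fun i => ?_, hB.sum_coords x⟩
  by_cases hi : i ∈ B
  · exact (h i hi).1
  · rw [hB.coords_of_notMem x hi]

open Classical in
/-- The series of the closed cone. -/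
theorem series_inCone (l : Fin n) (hl : ∀ i, W i l = 1)
    (hw : Submodule.span ℝ (Set.range fun i => castVec (W i)) = ⊤)
    (hω : GenericObjective (fun i => castVec (W i)) ω) {c : ι → ℝ} (hc : ∀ i, 0 < c i)
    (hy : GenericVector (fun i => castVec (W i)) (∑ i, c i • castVec (W i))) :
    (1 - PowerSeries.X : PowerSeries ℤ) ^ n * PowerSeries.mk (fun m => (Nat.card
      {x : Fin n → ℤ // InCone (fun i => castVec (W i)) (castVec x) ∧ x l = m} : ℤ)) =
      ∑ θ : Σ B : OptBase W ω, (B.cone l hl).Q, PowerSeries.X ^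
        (θ.1.cone l hl).qhgt (θ.1.removed (∑ i, c i • castVec (W i))) θ.2 := by
  rw [← series_coneToward l hl hw hω hy]
  congr 2
  funext m
  congr 1
  refine Nat.card_congr (Equiv.subtypeEquivRight fun x => and_congr_left fun _ => ?_)
  refine ⟨coneToward_of_pos hc _, fun h => ?_⟩
  obtain ⟨B, hB, -, hBx⟩ :=
    (coneToward_iff_existsUnique hw (LinearMap.proj l) (by simp [hl]) hω hy _).1 h
  exact hBx.inCone

open Classical in
/-- Reciprocity: the series of the interior of the cone. -/
theorem series_interior (l : Fin n) (hl : ∀ i, W i l = 1)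
    (hw : Submodule.span ℝ (Set.range fun i => castVec (W i)) = ⊤)
    (hω : GenericObjective (fun i => castVec (W i)) ω) {y : Fin n → ℝ}
    (hy : GenericVector (fun i => castVec (W i)) y) :
    (1 - PowerSeries.X : PowerSeries ℤ) ^ n * PowerSeries.mk (fun m => (Nat.card
      {x : Fin n → ℤ // ConeToward (fun i => castVec (W i)) (-y) (castVec x) ∧ x l = m} : ℤ)) =
      ∑ θ : Σ B : OptBase W ω, (B.cone l hl).Q, PowerSeries.X ^
        (n - (θ.1.cone l hl).qhgt (θ.1.removed y) θ.2) := by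
  rw [series_coneToward l hl hw hω hy.neg, Fintype.sum_sigma, Fintype.sum_sigma]
  refine Finset.sum_congr rfl fun B _ => ?_
  refine Fintype.sum_equiv (Equiv.neg _) _ _ fun q => ?_
  have h := (B.cone l hl).qhgt_compl_neg (B.removed y) (-q)
  rw [neg_neg, B.card] at h
  rw [B.removed_neg hy, h]
  rfl

end OptBase

section Lift

theorem mem_convexHull_range_iff {ι E : Type} [Fintype ι] [AddCommGroup E] [Module ℝ E]
    (v : ι → E) (x : E) : x ∈ convexHull ℝ (Set.range v) ↔
      ∃ a : ι → ℝ, (∀ i, 0 ≤ a i) ∧ ∑ i, a i = 1 ∧ ∑ i, a i • v i = x := by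
  classical
  constructor
  · rintro h
    obtain ⟨J, _, w, z, hw, hw1, hz, rfl⟩ := mem_convexHull_iff_exists_fintype.1 h
    choose f hf using hz
    refine ⟨fun i => ∑ j with f j = i, w j, fun i => Finset.sum_nonneg fun j _ => hw j, ?_, ?_⟩
    · rw [← hw1]
      exact Finset.sum_fiberwise _ _ _
    · rw [← Finset.sum_fiberwise Finset.univ f]
      refine Finset.sum_congr rfl fun i _ => ?_
      rw [Finset.sum_smul]
      refine Finset.sum_congr rfl fun j hj => ?_
      rw [← hf j, (Finset.mem_filter.1 hj).2]
  · rintro ⟨a, h0, h1, hx⟩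
    exact mem_convexHull_of_exists_fintype a v h0 h1 (fun i => Set.mem_range_self i) hx

variable {d : ℕ} {ι : Type} [Fintype ι]

/-- The point of `ℝ^d` at height one given by the first `d` coordinates. -/
def dropLast (W : ι → Fin (d + 1) → ℤ) (i : ι) : Fin d → ℝ := fun j => W i j.castSucc

theorem sum_smul_castVec_eq_iff (W : ι → Fin (d + 1) → ℤ) (hl : ∀ i, W i (Fin.last d) = 1)
    (a : ι → ℝ) (x : Fin (d + 1) → ℝ) : ∑ i, a i • castVec (W i) = x ↔
      ∑ i, a i • dropLast W i = (fun j => x j.castSucc) ∧ ∑ i, a i = x (Fin.last d) := by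
  rw [funext_iff, Fin.forall_fin_succ', funext_iff]
  simp [Finset.sum_apply, dropLast, hl]

theorem inCone_iff (W : ι → Fin (d + 1) → ℤ) (hl : ∀ i, W i (Fin.last d) = 1) {m : ℕ}
    (hm : 0 < m) (x : Fin (d + 1) → ℤ) (hx : x (Fin.last d) = m) :
    InCone (fun i => castVec (W i)) (castVec x) ↔
      (fun j : Fin d => (x j.castSucc : ℝ)) ∈ (m : ℝ) • convexHull ℝ (Set.range (dropLast W)) := by
  have hm' : (m : ℝ) ≠ 0 := by positivity
  rw [Set.mem_smul_set_iff_inv_smul_mem₀ hm', mem_convexHull_range_iff]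
  unfold InCone
  simp only [sum_smul_castVec_eq_iff W hl, castVec_apply, hx]
  constructor
  · rintro ⟨a, ha, h1, h2⟩
    refine ⟨(m : ℝ)⁻¹ • a, fun i => ?_, ?_, ?_⟩
    · have := ha i
      simp only [Pi.smul_apply, smul_eq_mul]
      positivity
    · simp only [Pi.smul_apply, smul_eq_mul, ← Finset.mul_sum, h2]
      simp [hm']
    · simp only [Pi.smul_apply, smul_assoc, ← Finset.smul_sum, h1]
  · rintro ⟨a, ha, h1, h2⟩
    refine ⟨(m : ℝ) • a, fun i => ?_, ?_, ?_⟩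
    · have := ha i
      simp only [Pi.smul_apply, smul_eq_mul]
      positivity
    · simp only [Pi.smul_apply, smul_assoc, ← Finset.smul_sum, h2]
      rw [smul_inv_smul₀ hm']
    · simp only [Pi.smul_apply, smul_eq_mul, ← Finset.mul_sum, h1]
      simp

theorem ehrhartSeries_eq (W : ι → Fin (d + 1) → ℤ) (hl : ∀ i, W i (Fin.last d) = 1) :
    ehrhartSeries (convexHull ℝ (Set.range (dropLast W))) =
      PowerSeries.mk (fun m => (Nat.card {x : Fin (d + 1) → ℤ //
        InCone (fun i => castVec (W i)) (castVec x) ∧ x (Fin.last d) = m} : ℤ)) := by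
  ext m
  rw [ehrhartSeries, PowerSeries.coeff_mk, PowerSeries.coeff_mk]
  rcases Nat.eq_zero_or_pos m with rfl | hm
  · have : Nat.card {x : Fin (d + 1) → ℤ // InCone (fun i => castVec (W i)) (castVec x) ∧
        x (Fin.last d) = (0 : ℕ)} = 1 := by
      rw [Nat.card_eq_one_iff_unique]
      refine ⟨⟨?_⟩, ⟨⟨0, ⟨0, by simp, by simp⟩, by simp⟩⟩⟩
      have key : ∀ x : Fin (d + 1) → ℤ, InCone (fun i => castVec (W i)) (castVec x) →
          x (Fin.last d) = (0 : ℕ) → castVec x = 0 := by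
        rintro x ⟨a, ha, h⟩ hx
        have h2 := ((sum_smul_castVec_eq_iff W hl a _).1 h).2
        rw [castVec_apply, hx] at h2
        have h3 := (Finset.sum_eq_zero_iff_of_nonneg fun i _ => ha i).1 (by simpa using h2)
        rw [← h]
        exact Finset.sum_eq_zero fun i hi => by rw [h3 i hi, zero_smul]
      rintro ⟨x, hx, hx0⟩ ⟨y, hy, hy0⟩
      exact Subtype.ext (castVec_injective ((key x hx hx0).trans (key y hy hy0).symm))
    simp only [if_true, this, Nat.cast_one]
  · rw [if_neg hm.ne']
    congr 1
    rw [ehrhartCount, ← Nat.card_coe_set_eq]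
    symm
    refine Nat.card_congr (Equiv.ofBijective (fun x => ⟨fun j => (x.1 j.castSucc : ℝ),
      fun j => ⟨_, rfl⟩, (inCone_iff W hl hm x.1 x.2.2).1 x.2.1⟩) ⟨?_, ?_⟩)
    · rintro ⟨x, hx, hxm⟩ ⟨y, hy, hym⟩ h
      have h' := congrArg Subtype.val h
      refine Subtype.ext (funext (Fin.lastCases ?_ fun j => ?_))
      · exact hxm.trans hym.symm
      · have := congrFun h' j
        simpa using this
    · rintro ⟨x, hx, hxm⟩
      have hx' := hx
      choose z hz using hx'
      have hzx : (fun j : Fin d => ((Fin.snoc z (m : ℤ) : Fin (d + 1) → ℤ) j.castSucc : ℝ)) = x := by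
        ext j
        simp [hz]
      refine ⟨⟨Fin.snoc z m, ?_, by simp⟩, Subtype.ext hzx⟩
      rw [inCone_iff W hl hm _ (by simp), hzx]
      exact hxm

theorem span_eq_top_iff (W : ι → Fin (d + 1) → ℤ) (hl : ∀ i, W i (Fin.last d) = 1) :
    Submodule.span ℝ (Set.range fun i => castVec (W i)) = ⊤ ↔
      affineSpan ℝ (convexHull ℝ (Set.range (dropLast W))) = ⊤ := by
  rw [affineSpan_convexHull]
  constructor
  · intro h
    refine SetLike.ext fun p => ⟨fun _ => AffineSubspace.mem_top ℝ _ p, fun _ => ?_⟩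
    have hp : (Fin.snoc p (1 : ℝ) : Fin (d + 1) → ℝ) ∈
        Submodule.span ℝ (Set.range fun i => castVec (W i)) := h ▸ Submodule.mem_top
    obtain ⟨c, hc⟩ := (Submodule.mem_span_range_iff_exists_fun ℝ).1 hp
    obtain ⟨h1, h2⟩ := (sum_smul_castVec_eq_iff W hl c _).1 hc
    simp only [Fin.snoc_castSucc, Fin.snoc_last] at h1 h2
    change _ = p at h1
    rw [← h1, ← Finset.affineCombination_eq_linear_combination _ _ _ h2]
    exact affineCombination_mem_affineSpan h2 _
  · intro h
    have key : ∀ p : Fin d → ℝ, ∃ c : ι → ℝ, ∑ i, c i • dropLast W i = p ∧ ∑ i, c i = 1 := by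
      intro p
      have hp : p ∈ affineSpan ℝ (Set.range (dropLast W)) := h ▸ AffineSubspace.mem_top ℝ _ p
      obtain ⟨c, h1, h2⟩ := eq_affineCombination_of_mem_affineSpan_of_fintype hp
      exact ⟨c, by rw [h2, Finset.affineCombination_eq_linear_combination _ _ _ h1], h1⟩
    refine Submodule.eq_top_iff'.2 fun x => ?_
    rw [Submodule.mem_span_range_iff_exists_fun]
    obtain ⟨c, hc, hc1⟩ := key fun j => x j.castSucc
    obtain ⟨e, he, he1⟩ := key 0
    refine ⟨c + (x (Fin.last d) - 1) • e, ?_⟩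
    rw [sum_smul_castVec_eq_iff W hl]
    constructor
    · simp only [Pi.add_apply, Pi.smul_apply, add_smul, Finset.sum_add_distrib, smul_assoc,
        ← Finset.smul_sum, hc, he, smul_zero, add_zero]
    · simp only [Pi.add_apply, Pi.smul_apply, smul_eq_mul, Finset.sum_add_distrib,
        ← Finset.mul_sum, hc1, he1]
      ring

end Lift

section Counting

/-- The coefficient of `t^m` in `t^a / (1 - t)^(d+1)`. -/
def binomShift (d m a : ℕ) : ℤ := if a ≤ m then ((d + (m - a)).choose d : ℤ) else 0

theorem binomShift_self (d m : ℕ) : binomShift d m m = 1 := by simp [binomShift]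

theorem binomShift_succ (d m : ℕ) : binomShift d (m + 1) m = d + 1 := by
  simp [binomShift]

theorem binomShift_of_lt {d m a : ℕ} (h : m < a) : binomShift d m a = 0 := by
  simp [binomShift, h]

theorem coeff_X_pow_mul_choose (d m a : ℕ) : PowerSeries.coeff m ((PowerSeries.X : PowerSeries ℤ) ^ a *
    PowerSeries.mk fun n => ((d + n).choose d : ℤ)) = binomShift d m a := by
  rw [PowerSeries.coeff_X_pow_mul', PowerSeries.coeff_mk, binomShift]

theorem coeff_of_one_sub_X_pow_mul {d a b c e : ℕ} {A : PowerSeries ℤ}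
    (hA : (1 - PowerSeries.X) ^ (d + 1) * A =
      PowerSeries.X ^ a + PowerSeries.X ^ b + PowerSeries.X ^ c + PowerSeries.X ^ e) (m : ℕ) :
    PowerSeries.coeff m A =
      binomShift d m a + binomShift d m b + binomShift d m c + binomShift d m e := by
  have : A = (PowerSeries.X ^ a + PowerSeries.X ^ b + PowerSeries.X ^ c + PowerSeries.X ^ e) *
      PowerSeries.mk fun n => ((d + n).choose d : ℤ) := by
    rw [← hA, mul_comm ((1 - PowerSeries.X) ^ (d + 1)), mul_assoc, mul_comm ((1 - _) ^ _),
      PowerSeries.mk_add_choose_mul_one_sub_pow_eq_one, mul_one]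
  rw [this]
  simp only [add_mul, map_add, coeff_X_pow_mul_choose]

theorem sum_X_pow_fin_four (i1 i2 i3 : ℕ) :
    ∑ j : Fin 4, (PowerSeries.X : PowerSeries ℤ) ^ (![0, i1, i2, i3] j) =
      1 + PowerSeries.X ^ i1 + PowerSeries.X ^ i2 + PowerSeries.X ^ i3 := by
  simp [Fin.sum_univ_four]

/-- Equal generating functions come from equal multisets of exponents. -/
theorem map_univ_eq_of_sum_X_pow_eq {Θ Θ' : Type} [Fintype Θ] [Fintype Θ'] {h : Θ → ℕ}
    {h' : Θ' → ℕ}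
    (hh : ∑ θ, (PowerSeries.X : PowerSeries ℤ) ^ h θ = ∑ θ, PowerSeries.X ^ h' θ) :
    (Finset.univ : Finset Θ).val.map h = (Finset.univ : Finset Θ').val.map h' := by
  classical
  have key : ∀ {Θ : Type} [Fintype Θ] (h : Θ → ℕ) (k : ℕ),
      (((Finset.univ : Finset Θ).val.map h).count k : ℤ) =
        PowerSeries.coeff k (∑ θ, (PowerSeries.X : PowerSeries ℤ) ^ h θ) := by
    intro Θ _ h k
    rw [Multiset.count_map, map_sum]
    simp only [PowerSeries.coeff_X_pow, Finset.sum_boole]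
    rfl
  ext k
  have := key h k
  rw [hh, ← key h' k] at this
  exact_mod_cast this

theorem map_univ_eq_of_sum_X_pow {Θ : Type} [Fintype Θ] {h : Θ → ℕ} {i1 i2 i3 : ℕ}
    (hh : ∑ θ, (PowerSeries.X : PowerSeries ℤ) ^ h θ =
      1 + PowerSeries.X ^ i1 + PowerSeries.X ^ i2 + PowerSeries.X ^ i3) :
    (Finset.univ : Finset Θ).val.map h = {0, i1, i2, i3} := by
  rw [← sum_X_pow_fin_four] at hh
  rw [map_univ_eq_of_sum_X_pow_eq hh]
  rfl

theorem sum_eq_of_map_univ {Θ A : Type} [Fintype Θ] [AddCommMonoid A] {h : Θ → ℕ} {i1 i2 i3 : ℕ}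
    (hh : (Finset.univ : Finset Θ).val.map h = {0, i1, i2, i3}) (F : ℕ → A) :
    ∑ θ, F (h θ) = F 0 + F i1 + F i2 + F i3 := by
  have := congrArg (fun s => (s.map F).sum) hh
  simp only [Multiset.map_map] at this
  rw [Finset.sum]
  refine this.trans ?_
  simp [add_assoc]

end Counting

/-- A lattice polytope with given `δ`-polynomial is generated by its lattice points. -/
theorem exists_lattice_generators {d i1 i2 i3 : ℕ} (h1 : 1 ≤ i1) (h2 : 1 ≤ i2) (h3 : 1 ≤ i3)
    {P : Set (Fin d → ℝ)} (hP : IsLatticePolytope P) (hspan : affineSpan ℝ P = ⊤)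
    (hδ : HasDeltaPoly P (1 + X ^ i1 + X ^ i2 + X ^ i3)) :
    ∃ (ι : Type) (_ : Fintype ι) (W : ι → Fin (d + 1) → ℤ), Function.Injective W ∧
      (∀ i, W i (Fin.last d) = 1) ∧ Submodule.span ℝ (Set.range fun i => castVec (W i)) = ⊤ ∧
      Fintype.card ι = d + 1 + ((if i1 = 1 then 1 else 0) + (if i2 = 1 then 1 else 0) +
        (if i3 = 1 then 1 else 0)) ∧
      (1 - PowerSeries.X : PowerSeries ℤ) ^ (d + 1) * PowerSeries.mk (fun m => (Nat.card
        {x : Fin (d + 1) → ℤ // InCone (fun i => castVec (W i)) (castVec x) ∧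
          x (Fin.last d) = m} : ℤ)) =
        1 + PowerSeries.X ^ i1 + PowerSeries.X ^ i2 + PowerSeries.X ^ i3 := by
  have hser : (1 - PowerSeries.X : PowerSeries ℤ) ^ (d + 1) * ehrhartSeries P =
      1 + PowerSeries.X ^ i1 + PowerSeries.X ^ i2 + PowerSeries.X ^ i3 := by
    rw [hδ]; simp
  set S : Set (Fin d → ℝ) := latticePts d ∩ P with hS
  have hcount : (S.ncard : ℤ) = d + 1 + ((if i1 = 1 then 1 else 0) + (if i2 = 1 then 1 else 0) +
        (if i3 = 1 then 1 else 0)) := by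
    have hser' := hser
    rw [← pow_zero PowerSeries.X] at hser'
    have h := coeff_of_one_sub_X_pow_mul hser' 1
    have e : ehrhartCount P 1 = S.ncard := by simp [ehrhartCount, hS]
    have aux : ∀ i : ℕ, 1 ≤ i → binomShift d 1 i = if i = 1 then 1 else 0 := by
      intro i hi
      rcases Nat.lt_or_ge 1 i with h | h
      · rw [binomShift_of_lt h, if_neg (by omega)]
      · obtain rfl : i = 1 := by omega
        simp [binomShift_self]
    rw [ehrhartSeries, PowerSeries.coeff_mk, if_neg one_ne_zero, e, aux _ h1, aux _ h2, aux _ h3,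
      binomShift_succ d 0] at h
    rw [h]
    ring
  have hcount' : S.ncard = d + 1 + ((if i1 = 1 then 1 else 0) + (if i2 = 1 then 1 else 0) +
        (if i3 = 1 then 1 else 0)) := by exact_mod_cast hcount
  have hSfin : S.Finite := Set.finite_of_ncard_pos (by omega)
  have : Fintype S := hSfin.fintype
  choose z hz using fun s : S => s.2.1
  set W : S → Fin (d + 1) → ℤ := fun s => Fin.snoc (z s) 1 with hW
  have hl : ∀ s, W s (Fin.last d) = 1 := by simp [hW]
  have hdrop : dropLast W = ((↑) : S → Fin d → ℝ) := by
    ext s j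
    simp [dropLast, hW, hz]
  have hPS : P = convexHull ℝ (Set.range (dropLast W)) := by
    rw [hdrop, Subtype.range_coe]
    obtain ⟨V, hV, rfl⟩ := hP
    refine Set.Subset.antisymm (convexHull_mono fun v hv => ⟨hV hv, subset_convexHull ℝ _ hv⟩) ?_
    exact convexHull_min Set.inter_subset_right (convex_convexHull _ _)
  refine ⟨S, inferInstance, W, ?_, hl, ?_, ?_, ?_⟩
  · intro s t hst
    have : dropLast W s = dropLast W t := by unfold dropLast; rw [hst]
    rw [hdrop] at this
    exact Subtype.ext this
  · rw [span_eq_top_iff W hl, ← hPS, hspan]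
  · rw [← hcount', ← Nat.card_eq_fintype_card, Nat.card_coe_set_eq]
  · rw [← ehrhartSeries_eq W hl, ← hPS, hser]

section Fract

theorem fract_intCast_div (z : ℤ) (N : ℕ) (hN : 0 < N) :
    Int.fract ((z : ℝ) / N) = ((z % N : ℤ) : ℝ) / N := by
  have hN' : (0 : ℝ) < N := by exact_mod_cast hN
  rw [Int.fract_eq_iff]
  have h0 := Int.emod_nonneg z (by omega : (N : ℤ) ≠ 0)
  have h1 := Int.emod_lt_of_pos z (by omega : (0 : ℤ) < N)
  refine ⟨by positivity, ?_, z / N, ?_⟩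
  · rw [div_lt_one hN']
    exact_mod_cast h1
  · have h2 : ((N : ℤ) : ℝ) * ((z / N : ℤ) : ℝ) + ((z % N : ℤ) : ℝ) = z := by
      exact_mod_cast Int.mul_ediv_add_emod z N
    rw [← sub_div, eq_comm, eq_div_iff hN'.ne']
    push_cast at h2 ⊢
    linarith

theorem fract_add_fract_neg_le (t : ℝ) : Int.fract t + Int.fract (-t) ≤ 1 := by
  by_cases h : Int.fract t = 0
  · have := (Int.fract_lt_one (-t)).le
    linarith
  · rw [Int.fract_neg h]
    linarith

theorem two_mul_fract_two_mul_le {t : ℝ} {z : ℤ} (h : 4 * t = z) :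
    2 * Int.fract (2 * t) ≤ Int.fract t + Int.fract (-t) := by
  have e1 : t = (z : ℝ) / (4 : ℕ) := by push_cast; linarith
  have e2 : 2 * t = ((2 * z : ℤ) : ℝ) / (4 : ℕ) := by push_cast; linarith
  have e3 : -t = ((-z : ℤ) : ℝ) / (4 : ℕ) := by push_cast; linarith
  rw [e2, e3, e1, fract_intCast_div _ 4 (by norm_num), fract_intCast_div _ 4 (by norm_num),
    fract_intCast_div _ 4 (by norm_num)]
  have : 2 * (2 * z % (4 : ℕ)) ≤ z % (4 : ℕ) + -z % (4 : ℕ) := by omega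
  have h' : (2 : ℝ) * ((2 * z % (4 : ℕ) : ℤ) : ℝ) ≤ ((z % (4 : ℕ) : ℤ) : ℝ) +
    ((-z % (4 : ℕ) : ℤ) : ℝ) := by exact_mod_cast this
  rw [← add_div, mul_div_assoc', div_le_div_iff_of_pos_right (by norm_num)]
  exact h'

theorem fract_add_fract_add_fract_le {s t : ℝ} {z w : ℤ} (hs : 2 * s = z) (ht : 2 * t = w) :
    Int.fract s + Int.fract t + Int.fract (s + t) ≤ 1 := by
  have e1 : s = (z : ℝ) / (2 : ℕ) := by push_cast; linarith
  have e2 : t = (w : ℝ) / (2 : ℕ) := by push_cast; linarith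
  have e3 : s + t = ((z + w : ℤ) : ℝ) / (2 : ℕ) := by push_cast; linarith
  rw [e3, e1, e2, fract_intCast_div _ 2 (by norm_num), fract_intCast_div _ 2 (by norm_num),
    fract_intCast_div _ 2 (by norm_num)]
  have : z % (2 : ℕ) + w % (2 : ℕ) + (z + w) % (2 : ℕ) ≤ 2 := by omega
  have h' : ((z % (2 : ℕ) : ℤ) : ℝ) + ((w % (2 : ℕ) : ℤ) : ℝ) + (((z + w) % (2 : ℕ) : ℤ) : ℝ) ≤ 2 := by
    exact_mod_cast this
  rw [← add_div, ← add_div, div_le_one (by norm_num)]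
  exact h'

end Fract

theorem exists_enumeration {Θ : Type} [Fintype Θ] {h : Θ → ℕ} {i0 i1 i2 i3 : ℕ}
    (hh : (Finset.univ : Finset Θ).val.map h = {i0, i1, i2, i3}) :
    ∃ a b c e : Θ, h a = i0 ∧ h b = i1 ∧ h c = i2 ∧ h e = i3 ∧
      (∀ t, t = a ∨ t = b ∨ t = c ∨ t = e) ∧ a ≠ b ∧ a ≠ c ∧ a ≠ e ∧ b ≠ c ∧ b ≠ e ∧ c ≠ e := by
  classical
  obtain ⟨a, ha, ea, h1⟩ := (Multiset.map_eq_cons _ _ _ _).2 hh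
  obtain ⟨b, hb, eb, h2⟩ := (Multiset.map_eq_cons _ _ _ _).2 h1
  obtain ⟨c, hc, ec, h3⟩ := (Multiset.map_eq_cons _ _ _ _).2 h2
  obtain ⟨e, he, ee, h4⟩ := (Multiset.map_eq_cons _ _ _ _).2 ((Multiset.cons_zero i3).symm ▸ h3)
  have hs : (Finset.univ : Finset Θ).val = a ::ₘ b ::ₘ c ::ₘ e ::ₘ 0 := by
    rw [← Multiset.map_eq_zero.1 h4, Multiset.cons_erase he, Multiset.cons_erase hc,
      Multiset.cons_erase hb, Multiset.cons_erase ha]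
  refine ⟨a, b, c, e, ea, eb, ec, ee, fun t => ?_, ?_⟩
  · have : t ∈ (Finset.univ : Finset Θ).val := Finset.mem_univ t
    rw [hs] at this
    simpa using this
  · have := (Finset.univ : Finset Θ).nodup
    rw [hs] at this
    simp only [Multiset.nodup_cons, Multiset.mem_cons, Multiset.notMem_zero, not_or, or_false] at this
    tauto

namespace SimplicialCone

variable {M : Type} [AddCommGroup M] {κ : Type} [Fintype κ] [DecidableEq κ]
  (C : SimplicialCone M κ)

open Classical in
theorem cast_qhgt (S : Set κ) (x : M) :
    (C.qhgt S (x : C.Q) : ℝ) = ∑ k, (C.crd x k - hfloor (k ∈ S) (C.crd x k)) := by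
  have h : ((C.qhgt S (x : C.Q) : ℤ) : ℝ) = (C.hgt S x : ℝ) := by rw [C.qhgt_mk]
  rw [Int.cast_natCast] at h
  rw [h, hgt, Int.cast_sub, ← C.sum_crd, Int.cast_sum, ← Finset.sum_sub_distrib]

theorem cast_qhgt_empty (x : M) :
    (C.qhgt ∅ (x : C.Q) : ℝ) = ∑ k, Int.fract (C.crd x k) := by
  classical
  rw [cast_qhgt]
  refine Finset.sum_congr rfl fun k _ => ?_
  rw [hfloor, if_neg (Set.notMem_empty k), Int.fract]

theorem qhgt_empty_zero : C.qhgt ∅ 0 = 0 := by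
  have := C.cast_qhgt_empty 0
  rw [QuotientAddGroup.mk_zero] at this
  simp only [map_zero, Pi.zero_apply, Int.fract_zero, Finset.sum_const_zero] at this
  exact_mod_cast this

theorem qhgt_add_le (p q : C.Q) : C.qhgt ∅ (p + q) ≤ C.qhgt ∅ p + C.qhgt ∅ q := by
  induction p using QuotientAddGroup.induction_on with
  | _ x =>
  induction q using QuotientAddGroup.induction_on with
  | _ y =>
  have : (C.qhgt ∅ ((x + y : M) : C.Q) : ℝ) ≤ C.qhgt ∅ (x : C.Q) + C.qhgt ∅ (y : C.Q) := by
    simp only [cast_qhgt_empty, ← Finset.sum_add_distrib, map_add, Pi.add_apply]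
    exact Finset.sum_le_sum fun k _ => Int.fract_add_le _ _
  exact_mod_cast this

theorem qhgt_add_qhgt_neg_le (q : C.Q) : C.qhgt ∅ q + C.qhgt ∅ (-q) ≤ Fintype.card κ := by
  induction q using QuotientAddGroup.induction_on with
  | _ x =>
  have : (C.qhgt ∅ (x : C.Q) : ℝ) + C.qhgt ∅ ((-x : M) : C.Q) ≤ Fintype.card κ := by
    simp only [cast_qhgt_empty, ← Finset.sum_add_distrib, map_neg, Pi.neg_apply]
    refine (Finset.sum_le_sum fun k _ => fract_add_fract_neg_le _).trans ?_
    simp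
  exact_mod_cast this

theorem exists_crd_nsmul {x : M} {N : ℕ} (h : N • (x : C.Q) = 0) (k : κ) :
    ∃ z : ℤ, (N : ℝ) * C.crd x k = z := by
  have h' : ((N • x : M) : C.Q) = 0 := h
  rw [QuotientAddGroup.eq_zero_iff, C.mem_sub] at h'
  obtain ⟨z, hz⟩ := h' k
  exact ⟨z, by rw [← hz]; simp⟩

theorem two_mul_qhgt_two_nsmul_le {q : C.Q} (h : 4 • q = 0) :
    2 * C.qhgt ∅ (2 • q) ≤ C.qhgt ∅ q + C.qhgt ∅ (-q) := by
  induction q using QuotientAddGroup.induction_on with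
  | _ x =>
  have : 2 * (C.qhgt ∅ ((2 • x : M) : C.Q) : ℝ) ≤
      (C.qhgt ∅ (x : C.Q) : ℝ) + C.qhgt ∅ ((-x : M) : C.Q) := by
    simp only [cast_qhgt_empty, ← Finset.sum_add_distrib, map_neg, Pi.neg_apply, map_nsmul,
      Finset.mul_sum, Pi.smul_apply, nsmul_eq_mul, Nat.cast_ofNat]
    refine Finset.sum_le_sum fun k _ => ?_
    obtain ⟨z, hz⟩ := C.exists_crd_nsmul h k
    exact two_mul_fract_two_mul_le hz
  exact_mod_cast this

theorem qhgt_klein_le {p q : C.Q} (hp : 2 • p = 0) (hq : 2 • q = 0) :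
    C.qhgt ∅ p + C.qhgt ∅ q + C.qhgt ∅ (p + q) ≤ Fintype.card κ := by
  induction p using QuotientAddGroup.induction_on with
  | _ x =>
  induction q using QuotientAddGroup.induction_on with
  | _ y =>
  have : (C.qhgt ∅ (x : C.Q) : ℝ) + C.qhgt ∅ (y : C.Q) + C.qhgt ∅ ((x + y : M) : C.Q) ≤
      Fintype.card κ := by
    simp only [cast_qhgt_empty, ← Finset.sum_add_distrib, map_add, Pi.add_apply]
    refine (Finset.sum_le_sum (g := fun _ => (1 : ℝ)) fun k _ => ?_).trans (by simp)
    obtain ⟨z, hz⟩ := C.exists_crd_nsmul hp k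
    obtain ⟨w, hw⟩ := C.exists_crd_nsmul hq k
    exact fract_add_fract_add_fract_le hz hw
  exact_mod_cast this

theorem cyclic_inequalities (hQ : ∀ q : C.Q, 4 • q = 0) {q r s : C.Q}
    (hall : ∀ t : C.Q, t = 0 ∨ t = q ∨ t = r ∨ t = s) (hq : q ≠ 0) (hr : r ≠ 0) (h : 2 • q = r) :
    2 * C.qhgt ∅ r ≤ C.qhgt ∅ q + C.qhgt ∅ s ∧ C.qhgt ∅ q + C.qhgt ∅ s ≤ Fintype.card κ ∧
      C.qhgt ∅ s ≤ C.qhgt ∅ q + C.qhgt ∅ r ∧ C.qhgt ∅ q ≤ C.qhgt ∅ r + C.qhgt ∅ s := by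
  have h4 := hQ q
  have hs : -q = s := by
    rcases hall (-q) with h' | h' | h' | h'
    · exact absurd (neg_eq_zero.1 h') hq
    · refine absurd ?_ hr
      rw [← h, two_nsmul]
      nth_rewrite 1 [← h']
      simp
    · refine absurd ?_ hq
      have h3 : 3 • q = 0 := by
        have : 3 • q = 2 • q - -q := by abel
        rw [this, h', h, sub_self]
      have : q = 4 • q - 3 • q := by abel
      rw [this, h4, h3, sub_self]
    · exact h'
  refine ⟨?_, ?_, ?_, ?_⟩
  · rw [← h, ← hs]; exact C.two_mul_qhgt_two_nsmul_le h4
  · rw [← hs]; exact C.qhgt_add_qhgt_neg_le q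
  · have : s = q + r := by
      have : -q = q + 2 • q - 4 • q := by abel
      rw [← hs, this, h4, h, sub_zero]
    nth_rewrite 1 [this]
    exact C.qhgt_add_le _ _
  · have : q = r + s := by rw [← h, ← hs]; abel
    nth_rewrite 1 [this]
    exact C.qhgt_add_le _ _

theorem order_four_inequalities [Fintype C.Q] {i1 i2 i3 : ℕ} (h1 : 1 ≤ i1) (h12 : i1 ≤ i2)
    (h23 : i2 ≤ i3)
    (h : (Finset.univ : Finset C.Q).val.map (C.qhgt ∅) = {0, i1, i2, i3}) :
    i3 ≤ i1 + i2 ∧ i1 + i3 ≤ Fintype.card κ ∧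
      (2 * i2 ≤ i1 + i3 ∨ i2 + i3 ≤ Fintype.card κ) := by
  classical
  have hcard : Fintype.card C.Q = 4 := by
    have := congrArg Multiset.card h
    rw [Multiset.card_map] at this
    exact this
  have hQ : ∀ q : C.Q, 4 • q = 0 := fun q => by rw [← hcard]; exact card_nsmul_eq_zero
  obtain ⟨q0, q1, q2, q3, e0, e1, e2, e3, hall, n01, n02, n03, n12, n13, n23⟩ :=
    exists_enumeration h
  have hz : q0 = 0 := by
    have := C.qhgt_empty_zero
    rcases hall 0 with h' | h' | h' | h'
    · exact h'.symm
    · rw [h', e1] at this; omega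
    · rw [h', e2] at this; omega
    · rw [h', e3] at this; omega
  subst hz
  by_cases hex : ∃ q : C.Q, 2 • q ≠ 0
  · obtain ⟨q, hq⟩ := hex
    have hq0 : q ≠ 0 := by rintro rfl; simp at hq
    have hne : 2 • q ≠ q := by
      intro h'
      rw [two_nsmul] at h'
      exact hq0 (by simpa using h')
    rcases hall q with rfl | rfl | rfl | rfl
    · exact absurd rfl hq0
    · rcases hall (2 • q) with h' | h' | h' | h'
      · exact absurd h' hq
      · exact absurd h' hne
      · have := C.cyclic_inequalities hQ hall hq0 n02.symm h'
        omega
      · have := C.cyclic_inequalities (s := q2) hQ (fun t => by have := hall t; tauto) hq0 n03.symm h'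
        omega
    · rcases hall (2 • q) with h' | h' | h' | h'
      · exact absurd h' hq
      · have := C.cyclic_inequalities (s := q3) hQ (fun t => by have := hall t; tauto) hq0 n01.symm h'
        omega
      · exact absurd h' hne
      · have := C.cyclic_inequalities (s := q1) hQ (fun t => by have := hall t; tauto) hq0 n03.symm h'
        omega
    · rcases hall (2 • q) with h' | h' | h' | h'
      · exact absurd h' hq
      · have := C.cyclic_inequalities (s := q2) hQ (fun t => by have := hall t; tauto) hq0 n01.symm h'
        omega
      · have := C.cyclic_inequalities (s := q1) hQ (fun t => by have := hall t; tauto) hq0 n02.symm h'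
        omega
      · exact absurd h' hne
  · push Not at hex
    have h12' : q1 + q2 = q3 := by
      rcases hall (q1 + q2) with h' | h' | h' | h'
      · refine absurd ?_ n12
        rw [← sub_eq_zero, ← h', ← sub_eq_zero]
        have := hex q2
        rw [two_nsmul] at this
        rw [← neg_eq_zero, ← this]
        abel
      · exact absurd (by simpa using h') n02.symm
      · exact absurd (by simpa using h') n01.symm
      · exact h'
    have a1 := C.qhgt_klein_le (hex q1) (hex q2)
    have a2 := C.qhgt_add_le q1 q2
    rw [h12'] at a1 a2
    omega

end SimplicialCone

section Simplex

variable {d : ℕ} {κ : Type} [Fintype κ] [DecidableEq κ]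

theorem inCone_iff_halfOpen {n : ℕ} (b : Module.Basis κ ℝ (Fin n → ℝ)) (β : κ → Fin n → ℤ)
    (hb : ∀ k, b k = castVec (β k)) (l : Fin n) (hl : ∀ k, β k l = 1) (x : Fin n → ℤ) :
    InCone (fun k => castVec (β k)) (castVec x) ↔
      (SimplicialCone.ofBasis b β hb l hl).HalfOpen ∅ x := by
  unfold InCone SimplicialCone.HalfOpen
  simp only [SimplicialCone.ofBasis_crd, Set.mem_empty_iff_false, false_imp_iff, and_true, ← hb]
  constructor
  · rintro ⟨a, ha, h⟩ k
    rw [← h, b.repr_sum_self]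
    exact ha k
  · exact fun h => ⟨fun k => b.repr (castVec x) k, h, b.sum_repr _⟩

/-- The series of a simplicial cone. -/
theorem series_simplex (b : Module.Basis κ ℝ (Fin (d + 1) → ℝ)) (β : κ → Fin (d + 1) → ℤ)
    (hb : ∀ k, b k = castVec (β k)) (hl : ∀ k, β k (Fin.last d) = 1)
    [Fintype (SimplicialCone.ofBasis b β hb _ hl).Q] :
    (1 - PowerSeries.X : PowerSeries ℤ) ^ (d + 1) * PowerSeries.mk (fun m => (Nat.card
      {x : Fin (d + 1) → ℤ // InCone (fun k => castVec (β k)) (castVec x) ∧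
        x (Fin.last d) = m} : ℤ)) = ∑ q : (SimplicialCone.ofBasis b β hb _ hl).Q,
      PowerSeries.X ^ (SimplicialCone.ofBasis b β hb _ hl).qhgt ∅ q := by
  have h := (SimplicialCone.ofBasis b β hb _ hl).series_halfOpen ∅
  have hcard : Fintype.card κ = d + 1 := by
    rw [← Module.finrank_eq_card_basis b, Module.finrank_fin_fun]
  rw [hcard] at h
  rw [← h]
  simp only [inCone_iff_halfOpen b β hb _ hl]
  rfl

/-- The inequalities for lattice simplices of normalized volume four. -/
theorem simplex_inequalities {W : κ → Fin (d + 1) → ℤ} (hl : ∀ i, W i (Fin.last d) = 1)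
    (hw : Submodule.span ℝ (Set.range fun i => castVec (W i)) = ⊤)
    (hcard : Fintype.card κ = d + 1) {i1 i2 i3 : ℕ} (h1 : 1 ≤ i1) (h12 : i1 ≤ i2) (h23 : i2 ≤ i3)
    (hser : (1 - PowerSeries.X : PowerSeries ℤ) ^ (d + 1) * PowerSeries.mk (fun m => (Nat.card
        {x : Fin (d + 1) → ℤ // InCone (fun i => castVec (W i)) (castVec x) ∧
          x (Fin.last d) = m} : ℤ)) =
        1 + PowerSeries.X ^ i1 + PowerSeries.X ^ i2 + PowerSeries.X ^ i3) :
    i3 ≤ i1 + i2 ∧ i1 + i3 ≤ d + 1 ∧ (2 * i2 ≤ i1 + i3 ∨ i2 + i3 ≤ d + 1) := by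
  have hfr : Fintype.card κ = Module.finrank ℝ (Fin (d + 1) → ℝ) := by
    rw [hcard, Module.finrank_fin_fun]
  set b := basisOfTopLeSpanOfCardEqFinrank (fun i => castVec (W i)) hw.ge hfr with hb
  have hb' : ∀ k, b k = castVec (W k) := fun k => by
    rw [hb, coe_basisOfTopLeSpanOfCardEqFinrank]
  have := SimplicialCone.finite_Q_ofBasis b W hb' _ hl
  have : Fintype (SimplicialCone.ofBasis b W hb' _ hl).Q := Fintype.ofFinite _
  rw [series_simplex b W hb' hl] at hser
  rw [← hcard]
  exact (SimplicialCone.ofBasis b W hb' _ hl).order_four_inequalities h1 h12 h23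
    (map_univ_eq_of_sum_X_pow hser)

end Simplex

section CyclicSimplex

variable {e : ℕ} (q : Fin (e + 2) → ℤ)

/-- A barycentric coordinate, other than the last one, of the cyclic simplex with weights `q`. -/
def cyclicCoord (i : Fin (e + 1)) : (Fin (e + 2) → ℝ) →ₗ[ℝ] ℝ :=
  (if i = 0 then 0 else LinearMap.proj i.castSucc) + (q i.castSucc / 4 : ℝ) • LinearMap.proj 0

/-- Barycentric coordinates of the cyclic simplex with weights `q`. -/
def cyclicCoords : (Fin (e + 2) → ℝ) →ₗ[ℝ] (Fin (e + 2) → ℝ) :=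
  LinearMap.pi (Fin.snoc (cyclicCoord q) (LinearMap.proj (Fin.last (e + 1)) - ∑ i, cyclicCoord q i))

theorem cyclicCoords_castSucc (x : Fin (e + 2) → ℝ) (i : Fin (e + 1)) :
    cyclicCoords q x i.castSucc =
      (if i = 0 then 0 else x i.castSucc) + q i.castSucc * (x 0 / 4) := by
  rw [cyclicCoords, LinearMap.pi_apply, Fin.snoc_castSucc, cyclicCoord]
  split_ifs <;> simp <;> ring

theorem cyclicCoords_last (x : Fin (e + 2) → ℝ) : cyclicCoords q x (Fin.last (e + 1)) =
    x (Fin.last (e + 1)) - ∑ i : Fin (e + 1), cyclicCoords q x i.castSucc := by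
  simp [cyclicCoords]

/-- The vertices, at height one, of the cyclic simplex with weights `q`. -/
def cyclicVertex (k : Fin (e + 2)) : Fin (e + 2) → ℤ :=
  Fin.snoc (fun i : Fin (e + 1) =>
    if k = 0 then (if i = 0 then 4 else -q i.castSucc) else if k = i.castSucc then 1 else 0) 1

theorem cyclicCoords_cyclicVertex (hq : q 0 = 1) (k : Fin (e + 2)) :
    cyclicCoords q (castVec (cyclicVertex q k)) = Pi.single k 1 := by
  have h0 : (0 : Fin (e + 2)) = (0 : Fin (e + 1)).castSucc := rfl
  have key : ∀ i : Fin (e + 1), cyclicCoords q (castVec (cyclicVertex q k)) i.castSucc =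
      (Pi.single k 1 : Fin (e + 2) → ℝ) i.castSucc := by
    intro i
    rw [cyclicCoords_castSucc]
    have e0 : castVec (cyclicVertex q k) 0 = if k = 0 then 4 else 0 := by
      rw [castVec_apply, cyclicVertex, h0, Fin.snoc_castSucc]
      by_cases hk : k = (0 : Fin (e + 1)).castSucc
      · rw [if_pos hk, if_pos hk, if_pos rfl]
        norm_num
      · rw [if_neg hk, if_neg hk, if_neg hk, Int.cast_zero]
    have ei : castVec (cyclicVertex q k) i.castSucc =
        if k = 0 then (if i = 0 then 4 else -(q i.castSucc : ℝ)) else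
          if k = i.castSucc then 1 else 0 := by
      rw [castVec_apply, cyclicVertex, Fin.snoc_castSucc]
      split_ifs <;> simp
    rw [e0, ei, Pi.single_apply]
    by_cases hk : k = 0
    · subst hk
      by_cases hi : i = 0
      · subst hi
        simp [hq]
      · have : i.castSucc ≠ 0 := fun h => hi (Fin.castSucc_injective _ (h.trans h0))
        simp [hi, this]
    · by_cases hi : i = 0
      · subst hi
        simp [hk, eq_comm]
      · simp [hk, hi, eq_comm]
  funext j
  refine Fin.lastCases ?_ key j
  rw [cyclicCoords_last, Finset.sum_congr rfl fun i _ => key i]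
  have := Fin.sum_univ_castSucc (Pi.single k 1 : Fin (e + 2) → ℝ)
  rw [Finset.sum_pi_single' ] at this
  simp at this
  rw [castVec_apply, cyclicVertex, Fin.snoc_last]
  push_cast
  linarith

end CyclicSimplex

section CyclicSimplex

variable {e : ℕ} (q : Fin (e + 2) → ℤ)

/-- The vertices of the cyclic simplex form a basis. -/
def cyclicBasis (hq : q 0 = 1) : Module.Basis (Fin (e + 2)) ℝ (Fin (e + 2) → ℝ) :=
  basisOfLinearIndependentOfCardEqFinrank (b := fun k => castVec (cyclicVertex q k))
    (LinearIndependent.of_comp (cyclicCoords q) (by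
      have : (cyclicCoords q ∘ fun k => castVec (cyclicVertex q k)) =
          Pi.basisFun ℝ (Fin (e + 2)) := by
        funext k
        rw [Function.comp_apply, cyclicCoords_cyclicVertex q hq, Pi.basisFun_apply]
      rw [this]
      exact Module.Basis.linearIndependent _)) (by simp)

theorem cyclicBasis_apply (hq : q 0 = 1) (k : Fin (e + 2)) :
    cyclicBasis q hq k = castVec (cyclicVertex q k) := by
  rw [cyclicBasis, coe_basisOfLinearIndependentOfCardEqFinrank]

theorem cyclicBasis_repr (hq : q 0 = 1) (x : Fin (e + 2) → ℝ) (k : Fin (e + 2)) :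
    (cyclicBasis q hq).repr x k = cyclicCoords q x k := by
  have : (cyclicBasis q hq).equivFun.toLinearMap = cyclicCoords q := by
    refine (cyclicBasis q hq).ext fun j => ?_
    rw [cyclicBasis_apply, cyclicCoords_cyclicVertex q hq, ← cyclicBasis_apply q hq]
    rw [LinearEquiv.coe_coe]
    funext i
    simp [Pi.single_apply, eq_comm]
  rw [← this]
  rfl

theorem cyclicVertex_last (k : Fin (e + 2)) : cyclicVertex q k (Fin.last (e + 1)) = 1 := by
  rw [cyclicVertex, Fin.snoc_last]

/-- The simplicial cone over the cyclic simplex. -/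
abbrev cyclicCone (hq : q 0 = 1) : SimplicialCone (Fin (e + 2) → ℤ) (Fin (e + 2)) :=
  SimplicialCone.ofBasis (cyclicBasis q hq) (cyclicVertex q) (cyclicBasis_apply q hq)
    (Fin.last (e + 1)) (cyclicVertex_last q)

theorem cyclicCone_crd (hq : q 0 = 1) (x : Fin (e + 2) → ℤ) (k : Fin (e + 2)) :
    (cyclicCone q hq).crd x k = cyclicCoords q (castVec x) k := by
  rw [SimplicialCone.ofBasis_crd, cyclicBasis_repr]

theorem mem_cyclicCone_sub (hq : q 0 = 1) (x : Fin (e + 2) → ℤ) :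
    x ∈ (cyclicCone q hq).sub ↔ (4 : ℤ) ∣ x 0 := by
  have h0 : (0 : Fin (e + 2)) = (0 : Fin (e + 1)).castSucc := rfl
  simp only [SimplicialCone.mem_sub, cyclicCone_crd]
  constructor
  · intro h
    obtain ⟨z, hz⟩ := h 0
    refine ⟨z, ?_⟩
    rw [h0, cyclicCoords_castSucc, if_pos rfl, ← h0, hq, castVec_apply] at hz
    have : (x 0 : ℝ) = 4 * z := by push_cast at hz; linarith
    exact_mod_cast this
  · rintro ⟨z, hz⟩
    have key : ∀ i : Fin (e + 1), cyclicCoords q (castVec x) i.castSucc =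
        (((if i = 0 then 0 else x i.castSucc) + q i.castSucc * z : ℤ) : ℝ) := by
      intro i
      rw [cyclicCoords_castSucc, castVec_apply, castVec_apply, hz]
      push_cast
      ring
    intro k
    refine Fin.lastCases ?_ (fun i => ⟨_, key i⟩) k
    refine ⟨x (Fin.last (e + 1)) - ∑ i : Fin (e + 1),
      ((if i = 0 then 0 else x i.castSucc) + q i.castSucc * z), ?_⟩
    rw [cyclicCoords_last, Finset.sum_congr rfl fun i _ => key i, castVec_apply]
    push_cast
    ring

theorem four_mul_qhgt_cyclicCone (hq : q 0 = 1) (hs : (4 : ℤ) ∣ ∑ k, q k) (j : ℤ) :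
    (4 * (cyclicCone q hq).qhgt ∅ ((Pi.single 0 j : Fin (e + 2) → ℤ) : (cyclicCone q hq).Q) : ℤ) =
      ∑ k, j * q k % 4 := by
  obtain ⟨s, hs⟩ := hs
  have h0 : (0 : Fin (e + 2)) = (0 : Fin (e + 1)).castSucc := rfl
  have key : ∀ i : Fin (e + 1), cyclicCoords q (castVec (Pi.single 0 j)) i.castSucc =
      ((j * q i.castSucc : ℤ) : ℝ) / (4 : ℕ) := by
    intro i
    rw [cyclicCoords_castSucc, castVec_apply, castVec_apply, Pi.single_eq_same]
    by_cases hi : i = 0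
    · rw [if_pos hi]
      push_cast
      ring
    · rw [if_neg hi, Pi.single_eq_of_ne (fun h => hi (Fin.castSucc_injective _ (h.trans h0)))]
      push_cast
      ring
  have hlast : cyclicCoords q (castVec (Pi.single 0 j)) (Fin.last (e + 1)) =
      ((j * q (Fin.last (e + 1)) : ℤ) : ℝ) / (4 : ℕ) + ((-(j * s) : ℤ) : ℝ) := by
    have hs' : ((∑ i : Fin (e + 1), q i.castSucc + q (Fin.last (e + 1)) : ℤ) : ℝ) =
        ((4 * s : ℤ) : ℝ) := by
      rw [← hs, Fin.sum_univ_castSucc q]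
    push_cast at hs'
    rw [cyclicCoords_last, Finset.sum_congr rfl fun i _ => key i, castVec_apply,
      Pi.single_eq_of_ne (Fin.last_pos.ne'), ← Finset.sum_div]
    push_cast
    rw [← Finset.mul_sum]
    linear_combination (-(j : ℝ) / 4) * hs'
  have hfr : ∀ k, Int.fract ((cyclicCone q hq).crd (Pi.single 0 j) k) =
      ((j * q k % 4 : ℤ) : ℝ) / 4 := by
    intro k
    rw [cyclicCone_crd]
    refine Fin.lastCases ?_ (fun i => ?_) k
    · rw [hlast, Int.fract_add_intCast, fract_intCast_div _ 4 (by norm_num)]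
      norm_num
    · rw [key, fract_intCast_div _ 4 (by norm_num)]
      norm_num
  have := (cyclicCone q hq).cast_qhgt_empty (Pi.single 0 j)
  rw [Finset.sum_congr rfl fun k _ => hfr k, ← Finset.sum_div] at this
  have h4 : (4 * (cyclicCone q hq).qhgt ∅ ((Pi.single 0 j : Fin (e + 2) → ℤ) :
      (cyclicCone q hq).Q) : ℝ) = ∑ k, ((j * q k % 4 : ℤ) : ℝ) := by
    rw [this]
    ring
  exact_mod_cast h4

theorem cyclicCone_Q_bijective (hq : q 0 = 1) : Function.Bijective
    (fun j : Fin 4 => ((Pi.single 0 (j : ℤ) : Fin (e + 2) → ℤ) : (cyclicCone q hq).Q)) := by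
  constructor
  · intro i j h
    have h' := QuotientAddGroup.eq.1 h
    rw [mem_cyclicCone_sub] at h'
    simp only [Pi.add_apply, Pi.neg_apply, Pi.single_eq_same] at h'
    omega
  · intro p
    induction p using QuotientAddGroup.induction_on with
    | _ x =>
    refine ⟨⟨(x 0 % 4).toNat, by omega⟩, ?_⟩
    rw [QuotientAddGroup.eq, mem_cyclicCone_sub]
    simp only [Pi.add_apply, Pi.neg_apply, Pi.single_eq_same]
    omega

theorem hasDeltaPoly_cyclic (hq : q 0 = 1) (hs : (4 : ℤ) ∣ ∑ k, q k) {a b c : ℕ}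
    (ha : ∑ k, 1 * q k % 4 = 4 * (a : ℤ)) (hb : ∑ k, 2 * q k % 4 = 4 * (b : ℤ))
    (hc : ∑ k, 3 * q k % 4 = 4 * (c : ℤ)) :
    HasDeltaPoly (convexHull ℝ (Set.range (dropLast (cyclicVertex q))))
      (1 + X ^ a + X ^ b + X ^ c) := by
  unfold HasDeltaPoly
  have : Fintype (cyclicCone q hq).Q := Fintype.ofBijective _ (cyclicCone_Q_bijective q hq)
  have h := fun j => four_mul_qhgt_cyclicCone q hq hs j
  have h0 := h 0
  have h1 := h 1
  have h2 := h 2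
  have h3 := h 3
  rw [ha] at h1
  rw [hb] at h2
  rw [hc] at h3
  simp only [zero_mul, Int.zero_emod, Finset.sum_const_zero] at h0
  rw [ehrhartSeries_eq _ (cyclicVertex_last q),
    series_simplex (cyclicBasis q hq) (cyclicVertex q) (cyclicBasis_apply q hq)
      (cyclicVertex_last q), ← Function.Bijective.sum_comp (cyclicCone_Q_bijective q hq)
      (fun p => (PowerSeries.X : PowerSeries ℤ) ^ (cyclicCone q hq).qhgt ∅ p), Fin.sum_univ_four]
  have e0 : (cyclicCone q hq).qhgt ∅
      ((Pi.single 0 (((0 : Fin 4) : ℕ) : ℤ) : Fin (e + 2) → ℤ) : (cyclicCone q hq).Q) = 0 := by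
    have : (((0 : Fin 4) : ℕ) : ℤ) = 0 := rfl
    rw [this]
    omega
  have e1 : (cyclicCone q hq).qhgt ∅
      ((Pi.single 0 (((1 : Fin 4) : ℕ) : ℤ) : Fin (e + 2) → ℤ) : (cyclicCone q hq).Q) = a := by
    have : (((1 : Fin 4) : ℕ) : ℤ) = 1 := rfl
    rw [this]
    omega
  have e2 : (cyclicCone q hq).qhgt ∅
      ((Pi.single 0 (((2 : Fin 4) : ℕ) : ℤ) : Fin (e + 2) → ℤ) : (cyclicCone q hq).Q) = b := by
    have : (((2 : Fin 4) : ℕ) : ℤ) = 2 := rfl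
    rw [this]
    omega
  have e3 : (cyclicCone q hq).qhgt ∅
      ((Pi.single 0 (((3 : Fin 4) : ℕ) : ℤ) : Fin (e + 2) → ℤ) : (cyclicCone q hq).Q) = c := by
    have : (((3 : Fin 4) : ℕ) : ℤ) = 3 := rfl
    rw [this]
    omega
  rw [e0, e1, e2, e3]
  push_cast
  simp

end CyclicSimplex

theorem sum_fin_ite_lt {n m : ℕ} (h : m ≤ n) :
    ∑ k : Fin n, (if (k : ℕ) < m then (1 : ℤ) else 0) = m := by
  rw [Fin.sum_univ_eq_sum_range (fun k => if k < m then (1 : ℤ) else 0) n, Finset.sum_ite,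
    Finset.sum_const_zero, add_zero, Finset.sum_const, nsmul_one]
  congr 1
  have : {x ∈ Finset.range n | x < m} = Finset.range m := by
    ext x
    simp only [Finset.mem_filter, Finset.mem_range]
    omega
  rw [this, Finset.card_range]

theorem isLatticePolytope_dropLast {ι : Type} [Fintype ι] {d : ℕ} (W : ι → Fin (d + 1) → ℤ) :
    IsLatticePolytope (convexHull ℝ (Set.range (dropLast W))) := by
  classical
  refine ⟨Finset.univ.image (dropLast W), ?_, by simp⟩
  intro x hx
  simp only [Finset.coe_image, Finset.coe_univ, Set.image_univ] at hx
  obtain ⟨i, rfl⟩ := hx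
  exact fun j => ⟨W i j.castSucc, rfl⟩

/-- Cyclic simplices realize all the `δ`-polynomials satisfying the inequalities. -/
theorem exists_cyclic_simplex {d a b c : ℕ} (hd : 1 ≤ d) (h1 : a < b + c) (h2 : 2 * b ≤ a + c)
    (h3 : c ≤ a + b) (h4 : a + c ≤ d + 1) :
    ∃ P : Set (Fin d → ℝ), IsLatticePolytope P ∧ affineSpan ℝ P = ⊤ ∧
      HasDeltaPoly P (1 + X ^ a + X ^ b + X ^ c) := by
  obtain ⟨e, rfl⟩ : ∃ e, d = e + 1 := ⟨d - 1, by omega⟩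
  obtain ⟨n1, hn1⟩ : ∃ n1, n1 + a = b + c := ⟨b + c - a, by omega⟩
  obtain ⟨n2, hn2⟩ : ∃ n2, n2 + n1 + b = 2 * c := ⟨2 * c - b - n1, by omega⟩
  set q : Fin (e + 2) → ℤ := fun k => if (k : ℕ) < n1 then 1 else if (k : ℕ) < n1 + n2 then 2 else
    if (k : ℕ) < a + c then 3 else 0 with hqdef
  have s1 := sum_fin_ite_lt (n := e + 2) (m := n1) (by omega)
  have s2 := sum_fin_ite_lt (n := e + 2) (m := n1 + n2) (by omega)
  have s3 := sum_fin_ite_lt (n := e + 2) (m := a + c) (by omega)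
  have hq : q 0 = 1 := if_pos (by rw [Fin.val_zero]; omega)
  have hsum : ∑ k, q k = 4 * (a : ℤ) := by
    have : ∀ k, q k = 3 * (if (k : ℕ) < a + c then (1 : ℤ) else 0) -
        (if (k : ℕ) < n1 + n2 then (1 : ℤ) else 0) - (if (k : ℕ) < n1 then (1 : ℤ) else 0) := by
      intro k
      simp only [hqdef]
      split_ifs <;> omega
    simp only [this, Finset.sum_sub_distrib, ← Finset.mul_sum, s1, s2, s3]
    push_cast
    omega
  have ha : ∑ k, 1 * q k % 4 = 4 * (a : ℤ) := by
    rw [← hsum]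
    refine Finset.sum_congr rfl fun k _ => ?_
    simp only [hqdef]
    split_ifs <;> rfl
  have hb : ∑ k, 2 * q k % 4 = 4 * (b : ℤ) := by
    have : ∀ k, 2 * q k % 4 = 2 * (if (k : ℕ) < a + c then (1 : ℤ) else 0) -
        2 * (if (k : ℕ) < n1 + n2 then (1 : ℤ) else 0) +
        2 * (if (k : ℕ) < n1 then (1 : ℤ) else 0) := by
      intro k
      simp only [hqdef]
      split_ifs <;> omega
    simp only [this, Finset.sum_sub_distrib, Finset.sum_add_distrib, ← Finset.mul_sum, s1, s2, s3]
    push_cast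
    omega
  have hc : ∑ k, 3 * q k % 4 = 4 * (c : ℤ) := by
    have : ∀ k, 3 * q k % 4 = (if (k : ℕ) < a + c then (1 : ℤ) else 0) +
        (if (k : ℕ) < n1 + n2 then (1 : ℤ) else 0) + (if (k : ℕ) < n1 then (1 : ℤ) else 0) := by
      intro k
      simp only [hqdef]
      split_ifs <;> omega
    simp only [this, Finset.sum_add_distrib, s1, s2, s3]
    push_cast
    omega
  refine ⟨_, isLatticePolytope_dropLast (cyclicVertex q), ?_,
    hasDeltaPoly_cyclic q hq ⟨a, hsum⟩ ha hb hc⟩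
  rw [← span_eq_top_iff _ (cyclicVertex_last q)]
  have : (fun k => castVec (cyclicVertex q k)) = cyclicBasis q hq :=
    funext fun k => (cyclicBasis_apply q hq k).symm
  rw [this]
  exact (cyclicBasis q hq).span_eq

section Interior

theorem ConeToward.add_generator {ι E : Type} [Fintype ι] [AddCommGroup E] [Module ℝ E]
    {w : ι → E} {y x : E} (h : ConeToward w y x) (i : ι) : ConeToward w y (x + w i) := by
  classical
  refine h.mono fun ε hε => ?_
  obtain ⟨a, ha, hx⟩ := hε
  refine ⟨a + Pi.single i 1, fun j => ?_, ?_⟩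
  · have : (0 : ℝ) ≤ (Pi.single i 1 : ι → ℝ) j := by
      rw [Pi.single_apply]
      split_ifs <;> norm_num
    exact add_nonneg (ha j) this
  · simp only [Pi.add_apply, add_smul, Finset.sum_add_distrib, hx]
    simp [Pi.single_apply]
    abel

variable {d : ℕ} {ι : Type} [Fintype ι] {W : ι → Fin (d + 1) → ℤ}

/-- A consequence of reciprocity: if the lattice polytope has many lattice points, then its two
leading `δ`-exponents are close to each other. -/
theorem card_generators_le (hinj : Function.Injective W) (hl : ∀ i, W i (Fin.last d) = 1)
    (hw : Submodule.span ℝ (Set.range fun i => castVec (W i)) = ⊤) {i1 i2 i3 : ℕ}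
    (h1 : 1 ≤ i1) (h12 : i1 ≤ i2) (h23 : i2 < i3) (h3 : i3 ≤ d)
    (hser : (1 - PowerSeries.X : PowerSeries ℤ) ^ (d + 1) * PowerSeries.mk (fun m => (Nat.card
        {x : Fin (d + 1) → ℤ // InCone (fun i => castVec (W i)) (castVec x) ∧
          x (Fin.last d) = m} : ℤ)) =
        1 + PowerSeries.X ^ i1 + PowerSeries.X ^ i2 + PowerSeries.X ^ i3) :
    Fintype.card ι ≤ d + 1 + (if i1 + 1 = i3 then 1 else 0) + (if i2 + 1 = i3 then 1 else 0) := by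
  classical
  obtain ⟨ω, hω⟩ := exists_genericObjective (fun i => castVec (W i))
  obtain ⟨c, hc, hy⟩ := exists_genericVector (fun i => castVec (W i))
  rw [series_inCone _ hl hw hω hc hy] at hser
  have hmap := map_univ_eq_of_sum_X_pow hser
  have h_int := series_interior _ hl hw hω hy
  rw [sum_eq_of_map_univ hmap (fun k => (PowerSeries.X : PowerSeries ℤ) ^ (d + 1 - k))] at h_int
  have hcoeff := coeff_of_one_sub_X_pow_mul h_int
  simp only [PowerSeries.coeff_mk] at hcoeff
  obtain ⟨l, hlD⟩ : ∃ l, d + 1 - i3 = l := ⟨_, rfl⟩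
  have e0 := hcoeff l
  have e1 := hcoeff (l + 1)
  rw [hlD, binomShift_self, binomShift_of_lt (by omega), binomShift_of_lt (by omega),
    binomShift_of_lt (by omega)] at e0
  rw [hlD, binomShift_succ, binomShift_of_lt (by omega : l + 1 < d + 1 - 0)] at e1
  have aux : ∀ i, i < i3 → binomShift d (l + 1) (d + 1 - i) = if i + 1 = i3 then 1 else 0 := by
    intro i hi
    split_ifs with h
    · rw [show d + 1 - i = l + 1 by omega, binomShift_self]
    · exact binomShift_of_lt (by omega)
  rw [aux i1 (by omega), aux i2 h23] at e1
  set I : ℕ → Type := fun m => {x : Fin (d + 1) → ℤ // ConeToward (fun i => castVec (W i))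
    (-∑ i, c i • castVec (W i)) (castVec x) ∧ x (Fin.last d) = m}
  have hfin : Finite (I (l + 1)) := finite_coneToward _ hl hw hω hy.neg (l + 1)
  have hne : Nat.card (I l) ≠ 0 := by
    intro h
    have : (Nat.card (I l) : ℤ) = 1 := by
      rw [e0]
      norm_num
    omega
  obtain ⟨x0, hx0, hx0l⟩ := (Nat.card_ne_zero.1 hne).1
  have hcard : Nat.card ι ≤ Nat.card (I (l + 1)) := by
    refine Nat.card_le_card_of_injective (fun i : ι => (⟨x0 + W i, ?_, ?_⟩ : I (l + 1))) ?_
    · rw [map_add]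
      exact hx0.add_generator i
    · rw [Pi.add_apply, hx0l, hl]
      push_cast
      ring
    · intro i j hij
      exact hinj (add_left_cancel (congrArg Subtype.val hij))
  rw [Nat.card_eq_fintype_card] at hcard
  have e1' : (Nat.card (I (l + 1)) : ℤ) = 0 + (if i1 + 1 = i3 then 1 else 0) +
    (if i2 + 1 = i3 then 1 else 0) + (d + 1) := e1
  zify
  split_ifs at e1' ⊢ <;> omega

end Interior

namespace SimplicialCone

variable {M : Type} [AddCommGroup M] {κ : Type} [Fintype κ] [DecidableEq κ]
  (C : SimplicialCone M κ)

theorem qhgt_mk_zero (S : Set κ) : C.qhgt S 0 = S.ncard := by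
  classical
  have h := C.cast_qhgt S 0
  rw [QuotientAddGroup.mk_zero] at h
  have : ∀ k, C.crd 0 k - hfloor (k ∈ S) (C.crd 0 k) = if k ∈ S then 1 else 0 := by
    intro k
    rw [map_zero, Pi.zero_apply, hfloor]
    split_ifs <;> simp
  rw [Finset.sum_congr rfl fun k _ => this k, Finset.sum_boole] at h
  rw [Set.ncard_eq_toFinset_card', ← Set.filter_mem_univ_eq_toFinset]
  exact_mod_cast h

/-- Removing a facet does not matter for the points with nonintegral coordinate. -/
theorem qhgt_singleton_of_nonintegral {x : M} {k : κ} (hk : ∀ z : ℤ, C.crd x k ≠ z) :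
    C.qhgt {k} (x : C.Q) = C.qhgt ∅ (x : C.Q) := by
  classical
  have : (C.qhgt {k} (x : C.Q) : ℝ) = C.qhgt ∅ (x : C.Q) := by
    rw [cast_qhgt, cast_qhgt]
    refine Finset.sum_congr rfl fun j _ => ?_
    unfold hfloor
    rw [if_neg (Set.notMem_empty j)]
    split_ifs with hj
    · rw [Set.mem_singleton_iff] at hj
      subst hj
      rw [(Int.ceil_eq_floor_add_one_iff_notMem _).2]
      · simp
      · rintro ⟨z, hz⟩
        exact hk z hz.symm
    · rfl
  exact_mod_cast this

theorem qhgt_singleton_of_integral {x : M} {k : κ} {z : ℤ} (hk : C.crd x k = z) :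
    C.qhgt {k} (x : C.Q) = C.qhgt ∅ (x : C.Q) + 1 := by
  classical
  have : (C.qhgt {k} (x : C.Q) : ℝ) = C.qhgt ∅ (x : C.Q) + 1 := by
    have h1 : (1 : ℝ) = ∑ j, if j = k then 1 else 0 := by simp
    rw [cast_qhgt, cast_qhgt, h1, ← Finset.sum_add_distrib]
    refine Finset.sum_congr rfl fun j _ => ?_
    unfold hfloor
    rw [if_neg (Set.notMem_empty j)]
    by_cases hj : j = k
    · subst hj
      rw [if_pos (Set.mem_singleton j), if_pos rfl, hk, Int.ceil_intCast, Int.floor_intCast]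
      push_cast
      ring
    · rw [if_neg (by rwa [Set.mem_singleton_iff]), if_neg hj, add_zero]
  exact_mod_cast this

theorem qhgt_add_qhgt_neg_lt {x : M} {k : κ} {z : ℤ} (hk : C.crd x k = z) :
    C.qhgt ∅ (x : C.Q) + C.qhgt ∅ (-(x : C.Q)) + 1 ≤ Fintype.card κ := by
  have : (C.qhgt ∅ (x : C.Q) : ℝ) + C.qhgt ∅ ((-x : M) : C.Q) + 1 ≤ Fintype.card κ := by
    have h1 : (1 : ℝ) = ∑ j, if j = k then 1 else 0 := by simp
    simp only [cast_qhgt_empty, map_neg, Pi.neg_apply]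
    rw [h1, ← Finset.sum_add_distrib, ← Finset.sum_add_distrib]
    refine (Finset.sum_le_sum (g := fun _ => (1 : ℝ)) fun j _ => ?_).trans (by simp)
    by_cases hj : j = k
    · subst hj
      rw [if_pos rfl, hk, ← Int.cast_neg, Int.fract_intCast, Int.fract_intCast]
      norm_num
    · rw [if_neg hj, add_zero]
      exact fract_add_fract_neg_le _
  exact_mod_cast this

end SimplicialCone

/-- Counting heights in the two groups attached to a circuit. -/
theorem circuit_heights_le {Q0 Q1 : Type} [AddCommGroup Q0] [AddCommGroup Q1] {h0 : Q0 → ℕ}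
    {h1 : Q1 → ℕ} {D i2 i3 : ℕ} {u v : Q0 ⊕ Q1} (huv : u ≠ v) (hu0 : u ≠ .inl 0) (hu1 : u ≠ .inr 0)
    (hv0 : v ≠ .inl 0) (hv1 : v ≠ .inr 0)
    (hall : ∀ t : Q0 ⊕ Q1, t = .inl 0 ∨ t = .inr 0 ∨ t = u ∨ t = v)
    (hu : Sum.elim h0 h1 u = i2) (hv : Sum.elim h0 h1 v = i3)
    (H0 : ∀ x, h0 x + h0 (-x) ≤ D)
    (H1 : ∀ z, z ≠ 0 → h1 z + h1 (-z) ≤ D ∨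
      ∃ x, x ≠ 0 ∧ h1 z = h0 x + 1 ∧ h0 x + h0 (-x) + 1 ≤ D) : i2 + i3 ≤ D := by
  have mixed : ∀ (x : Q0) (z : Q1), x ≠ 0 → z ≠ 0 → (∀ t : Q0, t = 0 ∨ t = x) →
      (∀ t : Q1, t = 0 ∨ t = z) → h0 x + h1 z ≤ D := by
    intro x z hx hz hX hZ
    have ex : -x = x := (hX (-x)).resolve_left (neg_ne_zero.2 hx)
    have ez : -z = z := (hZ (-z)).resolve_left (neg_ne_zero.2 hz)
    have h := H0 x
    rw [ex] at h
    rcases H1 z hz with h' | ⟨x', hx', e, h'⟩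
    · rw [ez] at h'
      omega
    · rw [(hX x').resolve_left hx', ex] at h'
      rw [(hX x').resolve_left hx'] at e
      omega
  have pair : ∀ {Q : Type} [AddCommGroup Q] {x z : Q}, x ≠ 0 → z ≠ 0 → x ≠ z →
      (∀ t : Q, t = 0 ∨ t = x ∨ t = z) → z = -x := by
    intro Q _ x z hx hz hxz hQ
    rcases hQ (x + z) with h | h | h
    · exact (neg_eq_of_add_eq_zero_right h).symm
    · exact absurd (add_eq_left.1 h) hz
    · exact absurd (add_eq_right.1 h) hx
  rcases u with x | x <;> rcases v with z | z <;>
    simp only [Sum.elim_inl, Sum.elim_inr, ne_eq, Sum.inl.injEq, Sum.inr.injEq, reduceCtorEq,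
      not_false_eq_true] at hu hv huv hu0 hu1 hv0 hv1
  · have := pair hu0 hv0 huv fun t => by simpa using hall (.inl t)
    subst this
    have := H0 x
    omega
  · have := mixed x z hu0 hv1 (fun t => by simpa using hall (.inl t))
      (fun t => by simpa using hall (.inr t))
    omega
  · have := mixed z x hv0 hu1 (fun t => by simpa using hall (.inl t))
      (fun t => by simpa using hall (.inr t))
    omega
  · have := pair hu1 hv1 huv fun t => by simpa using hall (.inr t)
    subst this
    rcases H1 x hu1 with h | ⟨x', hx', -⟩
    · omega
    · exact absurd (hall (.inl x')) (by simpa using hx')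

section Circuit

variable {ι E : Type} [Fintype ι] [AddCommGroup E] [Module ℝ E] {w : ι → E} {r : ι → ℝ}

/-- Up to scaling, `r` is the only linear relation of the family. -/
structure UniqueRelation (w : ι → E) (r : ι → ℝ) : Prop where
  ne_zero : r ≠ 0
  sum_smul : ∑ i, r i • w i = 0
  eq_smul : ∀ c : ι → ℝ, ∑ i, c i • w i = 0 → ∃ t : ℝ, c = t • r

theorem exists_uniqueRelation [FiniteDimensional ℝ E] (hw : Submodule.span ℝ (Set.range w) = ⊤)
    (hcard : Fintype.card ι = Module.finrank ℝ E + 1) : ∃ r, UniqueRelation w r := by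
  have h := (Fintype.linearCombination ℝ w).finrank_range_add_finrank_ker
  rw [Fintype.range_linearCombination, hw, finrank_top, Module.finrank_fintype_fun_eq_card,
    hcard, add_right_inj, finrank_eq_one_iff'] at h
  obtain ⟨⟨r, hr⟩, h0, h⟩ := h
  refine ⟨r, fun h' => h0 (Subtype.ext h'), ?_, fun c hc => ?_⟩
  · simpa [Fintype.linearCombination_apply] using hr
  · obtain ⟨t, ht⟩ := h ⟨c, by simpa [Fintype.linearCombination_apply] using hc⟩
    exact ⟨t, (congrArg Subtype.val ht).symm⟩

namespace UniqueRelation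

theorem neg (hr : UniqueRelation w r) : UniqueRelation w (-r) where
  ne_zero := neg_ne_zero.2 hr.ne_zero
  sum_smul := by simp [hr.sum_smul]
  eq_smul := fun c hc => by
    obtain ⟨t, ht⟩ := hr.eq_smul c hc
    exact ⟨-t, by simp [ht]⟩

theorem smul_eq (hr : UniqueRelation w r) [DecidableEq ι] {i : ι} (hi : r i ≠ 0) :
    w i = ∑ j ∈ Finset.univ.erase i, (-(r j) / r i) • w j := by
  have h := hr.sum_smul
  rw [← Finset.add_sum_erase _ _ (Finset.mem_univ i)] at h
  have h' : r i • w i = ∑ j ∈ Finset.univ.erase i, (-(r j)) • w j := by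
    rw [eq_neg_of_add_eq_zero_left h, ← Finset.sum_neg_distrib]
    simp only [neg_smul]
  rw [← inv_smul_smul₀ hi (w i), h', Finset.smul_sum]
  refine Finset.sum_congr rfl fun j _ => ?_
  rw [smul_smul]
  congr 1
  field_simp

theorem span_image_compl (hr : UniqueRelation w r) (hw : Submodule.span ℝ (Set.range w) = ⊤)
    {i : ι} (hi : r i ≠ 0) : Submodule.span ℝ (w '' {i}ᶜ) = ⊤ := by
  classical
  rw [eq_top_iff, ← hw, Submodule.span_le]
  have hmem : ∀ j, j ≠ i → w j ∈ Submodule.span ℝ (w '' {i}ᶜ) := fun j hj =>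
    Submodule.subset_span ⟨j, hj, rfl⟩
  rintro _ ⟨j, rfl⟩
  by_cases hj : j = i
  · subst hj
    rw [hr.smul_eq hi]
    exact Submodule.sum_mem _ fun k hk => Submodule.smul_mem _ _ (hmem k (Finset.ne_of_mem_erase hk))
  · exact hmem j hj

theorem isBase_compl (hr : UniqueRelation w r) (hw : Submodule.span ℝ (Set.range w) = ⊤)
    {i : ι} (hi : r i ≠ 0) : IsBase w {i}ᶜ := by
  classical
  refine ⟨?_, hr.span_image_compl hw hi⟩
  rw [linearIndepOn_iff']
  intro t g ht hg j hj
  obtain ⟨s, hs⟩ := hr.eq_smul (fun k => if k ∈ t then g k else 0) (by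
    rw [← hg]
    simp [ite_smul, Finset.sum_ite_mem])
  have hit : i ∉ t := fun h => ht h rfl
  have h1 := congrFun hs i
  have h2 := congrFun hs j
  simp only [hit, hj, if_true, if_false, Pi.smul_apply, smul_eq_mul] at h1 h2
  rw [h2, (mul_eq_zero.1 h1.symm).resolve_right hi, zero_mul]

theorem eq_compl (hr : UniqueRelation w r) {B : Set ι} (hB : IsBase w B) :
    ∃ i, r i ≠ 0 ∧ B = {i}ᶜ := by
  obtain ⟨i, hi, hri⟩ : ∃ i, i ∉ B ∧ r i ≠ 0 := by
    by_contra! h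
    exact hr.ne_zero ((hB.coords_unique h hr.sum_smul).symm.trans (map_zero _))
  refine ⟨i, hri, Set.Subset.antisymm (fun j hj h => hi (Set.mem_singleton_iff.1 h ▸ hj)) ?_⟩
  intro j hji
  have hji' : j ≠ i := hji
  by_contra hj
  obtain ⟨t, ht⟩ := hr.eq_smul _ (hB.sum_rel j)
  have h1 := congrFun ht i
  have h2 := congrFun ht j
  rw [hB.rel_of_notMem hi hji'.symm] at h1
  rw [hB.rel_self hj] at h2
  simp only [Pi.smul_apply, smul_eq_mul] at h1 h2
  rw [(mul_eq_zero.1 h1.symm).resolve_right hri, zero_mul] at h2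
  exact one_ne_zero h2

theorem rel_eq (hr : UniqueRelation w r) {i : ι} (hB : IsBase w {i}ᶜ) :
    hB.rel i = (r i)⁻¹ • r := by
  obtain ⟨t, ht⟩ := hr.eq_smul _ (hB.sum_rel i)
  have h := congrFun ht i
  rw [hB.rel_self (by simp), Pi.smul_apply, smul_eq_mul] at h
  rw [ht, eq_inv_of_mul_eq_one_left h.symm]

theorem coords_eq (hr : UniqueRelation w r) {i : ι} (hi : r i ≠ 0) (hB : IsBase w {i}ᶜ)
    (c : ι → ℝ) : hB.coords (∑ j, c j • w j) = fun j => c j - c i / r i * r j := by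
  refine hB.coords_unique (fun j hj => ?_) ?_
  · have : j = i := by simpa using hj
    subst this
    rw [div_mul_cancel₀ _ hi, sub_self]
  · simp only [sub_smul, Finset.sum_sub_distrib, mul_smul, ← Finset.smul_sum, hr.sum_smul,
      smul_zero, sub_zero]

/-- The objective function pairing with the relation. -/
def objective (_hr : UniqueRelation w r) : Module.Dual ℝ (ι → ℝ) :=
  ∑ j, r j • LinearMap.proj j

theorem objective_pos (hr : UniqueRelation w r) : 0 < hr.objective r := by
  obtain ⟨i, hi⟩ := Function.ne_iff.1 hr.ne_zero
  simp only [objective, LinearMap.coe_sum, Finset.sum_apply, LinearMap.smul_apply,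
    LinearMap.proj_apply, smul_eq_mul]
  exact Finset.sum_pos' (fun j _ => mul_self_nonneg _) ⟨i, Finset.mem_univ i, mul_self_pos.2 hi⟩

theorem genericObjective (hr : UniqueRelation w r) : GenericObjective w hr.objective := by
  intro B hB j hj
  obtain ⟨i, hi, rfl⟩ := hr.eq_compl hB
  have : j = i := by simpa using hj
  subst this
  rw [hr.rel_eq, map_smul, smul_eq_mul]
  exact mul_ne_zero (inv_ne_zero hi) hr.objective_pos.ne'

theorem optimal_iff (hr : UniqueRelation w r) {i : ι} (hB : IsBase w {i}ᶜ) :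
    hB.Optimal hr.objective ↔ 0 < r i := by
  have key : 0 < hr.objective (hB.rel i) ↔ 0 < r i := by
    rw [hr.rel_eq, map_smul, smul_eq_mul, mul_pos_iff_of_pos_right hr.objective_pos, inv_pos]
  rw [← key]
  refine ⟨fun h => h i (by simp), fun h j hj => ?_⟩
  have : j = i := by simpa using hj
  rwa [this]

end UniqueRelation

end Circuit

section OnePositive

variable {d : ℕ} {ι : Type} [Fintype ι] {W : ι → Fin (d + 1) → ℤ} {r : ι → ℝ}

/-- If a generator lies in the cone of the others, it can be dropped. -/
theorem UniqueRelation.inequalities_of_pos (hl : ∀ i, W i (Fin.last d) = 1)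
    (hw : Submodule.span ℝ (Set.range fun i => castVec (W i)) = ⊤)
    (hcard : Fintype.card ι = d + 2) {i1 i2 i3 : ℕ} (h1 : 1 ≤ i1) (h12 : i1 ≤ i2) (h23 : i2 ≤ i3)
    (hser : (1 - PowerSeries.X : PowerSeries ℤ) ^ (d + 1) * PowerSeries.mk (fun m => (Nat.card
        {x : Fin (d + 1) → ℤ // InCone (fun i => castVec (W i)) (castVec x) ∧
          x (Fin.last d) = m} : ℤ)) =
        1 + PowerSeries.X ^ i1 + PowerSeries.X ^ i2 + PowerSeries.X ^ i3)
    (hr : UniqueRelation (fun i => castVec (W i)) r) {i : ι} (hi : 0 < r i)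
    (hpos : ∀ j, j ≠ i → r j ≤ 0) :
    i3 ≤ i1 + i2 ∧ i1 + i3 ≤ d + 1 ∧ (2 * i2 ≤ i1 + i3 ∨ i2 + i3 ≤ d + 1) := by
  classical
  have hiff : ∀ x : Fin (d + 1) → ℝ, InCone (fun j : {j // j ≠ i} => castVec (W j)) x ↔
      InCone (fun i => castVec (W i)) x := by
    intro x
    have hsum : ∀ F : ι → Fin (d + 1) → ℝ, ∑ j : {j // j ≠ i}, F j =
        ∑ j ∈ Finset.univ.erase i, F j := fun F =>
      (Finset.sum_subtype _ (by simp) F).symm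
    constructor
    · rintro ⟨a, ha, rfl⟩
      refine ⟨fun j => if h : j ≠ i then a ⟨j, h⟩ else 0, fun j => ?_, ?_⟩
      · dsimp only
        split_ifs
        · exact ha _
        · exact le_rfl
      · rw [← Finset.add_sum_erase _ _ (Finset.mem_univ i), ← hsum]
        simp only [ne_eq, not_true_eq_false, dite_false, zero_smul, zero_add]
        refine Finset.sum_congr rfl fun j _ => ?_
        rw [dif_pos j.2]
    · rintro ⟨a, ha, rfl⟩
      refine ⟨fun j => a j + a i * (-(r j) / r i), fun j => ?_, ?_⟩
      · have := hpos j j.2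
        have := ha i
        have := ha j
        have : 0 ≤ -(r j) := by linarith
        positivity
      · rw [hsum (fun j => (a j + a i * (-(r j) / r i)) • castVec (W j)),
          ← Finset.add_sum_erase _ _ (Finset.mem_univ i)]
        simp only [add_smul, mul_smul, Finset.sum_add_distrib, ← Finset.smul_sum]
        rw [← hr.smul_eq hi.ne']
        exact add_comm _ _
  refine simplex_inequalities (W := fun j : {j // j ≠ i} => W j) (fun j => hl j) ?_ ?_ h1 h12 h23 ?_
  · rw [← hr.span_image_compl hw hi.ne']
    congr 1
    ext x
    simp
  · rw [Fintype.card_subtype_compl, hcard]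
    simp
  · simp only [hiff]
    exact hser

end OnePositive

section CircuitCones

variable {n : ℕ} {ι : Type} [Fintype ι] {W : ι → Fin n → ℤ} {r : ι → ℝ}

open Classical in
theorem OptBase.cast_qhgt_empty {ω : Module.Dual ℝ (ι → ℝ)} (B : OptBase W ω) (l : Fin n)
    (hl : ∀ i, W i l = 1) (x : Fin n → ℤ) :
    ((B.cone l hl).qhgt ∅ (x : (B.cone l hl).Q) : ℝ) =
      ∑ i, Int.fract (B.2.choose.coords (castVec x) i) := by
  rw [SimplicialCone.cast_qhgt_empty]
  simp only [B.cone_crd]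
  rw [← Finset.sum_subset (Finset.subset_univ (Set.toFinset B.1))]
  · exact (Finset.sum_subtype (Set.toFinset B.1) (p := (· ∈ B.1)) (by simp)
      (fun i => Int.fract (B.2.choose.coords (castVec x) i))).symm
  · intro i _ hi
    rw [B.2.choose.coords_of_notMem _ (by simpa using hi), Int.fract_zero]

namespace UniqueRelation

variable (hr : UniqueRelation (fun i => castVec (W i)) r)
  (hw : Submodule.span ℝ (Set.range fun i => castVec (W i)) = ⊤)

/-- The optimal base obtained by dropping a positive element of the relation. -/
def optBase {i : ι} (hi : 0 < r i) : OptBase W hr.objective :=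
  ⟨{i}ᶜ, hr.isBase_compl hw hi.ne', (hr.optimal_iff _).2 hi⟩

theorem exists_eq_optBase (B : OptBase W hr.objective) :
    ∃ (i : ι) (hi : 0 < r i), B = hr.optBase hw hi := by
  obtain ⟨B, hB, hopt⟩ := B
  obtain ⟨i, -, rfl⟩ := hr.eq_compl hB
  exact ⟨i, (hr.optimal_iff hB).1 hopt, rfl⟩

theorem mem_removed_iff {c : ι → ℝ} (hc : ∀ i, 0 < c i) {i : ι} (hi : 0 < r i)
    (j : (hr.optBase hw hi).1) :
    j ∈ (hr.optBase hw hi).removed (∑ i, c i • castVec (W i)) ↔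
      0 < r j ∧ c j / r j < c i / r i := by
  have e : (hr.optBase hw hi).2.choose.coords (∑ i, c i • castVec (W i)) j =
      c j - c i / r i * r j :=
    congrFun (hr.coords_eq hi.ne' (hr.isBase_compl hw hi.ne') c) j
  change (hr.optBase hw hi).2.choose.coords (∑ i, c i • castVec (W i)) j < 0 ↔ _
  rw [e]
  have h0 := div_pos (hc i) hi
  have h1 := hc j
  rcases le_or_gt (r j) 0 with hj | hj
  · refine ⟨fun h => ?_, fun h => absurd h.1 hj.not_gt⟩
    nlinarith
  · rw [sub_neg, div_lt_iff₀ hj]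
    exact ⟨fun h => ⟨hj, h⟩, fun h => h.2⟩

include hr hw in
theorem div_ne_div {c : ι → ℝ}
    (hy : GenericVector (fun i => castVec (W i)) (∑ i, c i • castVec (W i))) {i j : ι}
    (hi : 0 < r i) (hj : 0 < r j) (hij : j ≠ i) : c j / r j ≠ c i / r i := by
  intro h
  refine hy {i}ᶜ (hr.isBase_compl hw hi.ne') j hij
    ((congrFun (hr.coords_eq hi.ne' (hr.isBase_compl hw hi.ne') c) j).trans ?_)
  rw [← h, div_mul_cancel₀ _ hj.ne', sub_self]

variable (l : Fin n) (hl : ∀ i, W i l = 1)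

open Classical in
theorem heights_of_second_base {i0 i1 : ι} (h0 : 0 < r i0) (h1 : 0 < r i1) (h01 : i0 ≠ i1)
    (z : ((hr.optBase hw h1).cone l hl).Q) (hz : z ≠ 0) :
    ((hr.optBase hw h1).cone l hl).qhgt {⟨i0, h01⟩} z +
        ((hr.optBase hw h1).cone l hl).qhgt {⟨i0, h01⟩} (-z) ≤ n ∨
      ∃ x : ((hr.optBase hw h0).cone l hl).Q, x ≠ 0 ∧
        ((hr.optBase hw h1).cone l hl).qhgt {⟨i0, h01⟩} z =
          ((hr.optBase hw h0).cone l hl).qhgt ∅ x + 1 ∧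
        ((hr.optBase hw h0).cone l hl).qhgt ∅ x +
          ((hr.optBase hw h0).cone l hl).qhgt ∅ (-x) + 1 ≤ n := by
  obtain ⟨v, rfl⟩ := QuotientAddGroup.mk_surjective z
  have hc0 : Fintype.card (hr.optBase hw h0).1 = n := OptBase.card _
  have hc1 : Fintype.card (hr.optBase hw h1).1 = n := OptBase.card _
  set C0 := (hr.optBase hw h0).cone l hl with hC0
  set C1 := (hr.optBase hw h1).cone l hl with hC1
  set k : (hr.optBase hw h1).1 := ⟨i0, h01⟩ with hk
  set k' : (hr.optBase hw h0).1 := ⟨i1, h01.symm⟩ with hk'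
  have hB0 := hr.isBase_compl hw h0.ne'
  have hB1 := hr.isBase_compl hw h1.ne'
  have hcrd0 : ∀ x j, C0.crd x j = hB0.coords (castVec x) j := OptBase.cone_crd _ l hl
  have hcrd1 : ∀ x j, C1.crd x j = hB1.coords (castVec x) j := OptBase.cone_crd _ l hl
  by_cases h_int : ∃ t : ℤ, C1.crd v k = t
  · right
    obtain ⟨t, ht⟩ := h_int
    have hβ : C1.β k = W i0 := rfl
    set v' := v - t • W i0 with hv'
    have hvv : ((v' : Fin n → ℤ) : C1.Q) = (v : C1.Q) := by
      rw [QuotientAddGroup.eq]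
      intro j
      refine ⟨(Pi.single k t : _ → ℤ) j, ?_⟩
      rw [hv', neg_sub, sub_add_cancel, ← hβ, map_zsmul, C1.crd_β]
      simp [Pi.single_apply]
    have hv0 : C1.crd v' k = ((0 : ℤ) : ℝ) := by
      rw [hv', map_sub, map_zsmul, ← hβ, C1.crd_β]
      simp [ht]
    have hco : hB0.coords (castVec v') = hB1.coords (castVec v') := by
      refine hB0.coords_unique (fun j hj => ?_) (hB1.sum_coords _)
      have : j = i0 := by simpa using hj
      rw [this]
      have := hcrd1 v' k
      rw [hv0, Int.cast_zero] at this
      exact this.symm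
    have hk0 : C0.crd v' k' = ((0 : ℤ) : ℝ) := by
      rw [hcrd0, hco, Int.cast_zero]
      exact hB1.coords_of_notMem _ (by simp [hk'])
    refine ⟨(v' : C0.Q), ?_, ?_, ?_⟩
    · intro h
      apply hz
      rw [← hvv, QuotientAddGroup.eq_zero_iff]
      rw [QuotientAddGroup.eq_zero_iff] at h
      intro j
      rw [hcrd1, ← hco]
      by_cases hj : (j : ι) = i0
      · refine ⟨0, ?_⟩
        rw [hB0.coords_of_notMem _ (by simp [hj]), Int.cast_zero]
      · obtain ⟨s, hs⟩ := h ⟨j, hj⟩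
        exact ⟨s, by rw [← hs, hcrd0]⟩
    · rw [← hvv, C1.qhgt_singleton_of_integral hv0]
      congr 1
      have e0 := OptBase.cast_qhgt_empty (hr.optBase hw h0) l hl v'
      have e1 := OptBase.cast_qhgt_empty (hr.optBase hw h1) l hl v'
      have : ((C1.qhgt ∅ (v' : C1.Q) : ℕ) : ℝ) = (C0.qhgt ∅ (v' : C0.Q) : ℕ) :=
        e1.trans (Eq.trans (by
          change ∑ i, Int.fract (hB1.coords (castVec v') i) =
            ∑ i, Int.fract (hB0.coords (castVec v') i)
          rw [hco]) e0.symm)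
      exact_mod_cast this
    · exact (C0.qhgt_add_qhgt_neg_lt hk0).trans_eq hc0
  · left
    push Not at h_int
    rw [← QuotientAddGroup.mk_neg, C1.qhgt_singleton_of_nonintegral h_int,
      C1.qhgt_singleton_of_nonintegral (x := -v) (fun t h => h_int (-t) (by
        rw [map_neg, Pi.neg_apply] at h
        push_cast
        linarith)), QuotientAddGroup.mk_neg]
    exact (C1.qhgt_add_qhgt_neg_le _).trans_eq hc1

end UniqueRelation

end CircuitCones

section CircuitInequality

variable {d : ℕ} {ι : Type} [Fintype ι] {W : ι → Fin (d + 1) → ℤ} {r : ι → ℝ}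

theorem UniqueRelation.sum_eq_zero (hl : ∀ i, W i (Fin.last d) = 1)
    (hr : UniqueRelation (fun i => castVec (W i)) r) : ∑ i, r i = 0 := by
  have h := congrFun hr.sum_smul (Fin.last d)
  simpa [Finset.sum_apply, castVec_apply, hl] using h

open Classical in
/-- The case of a circuit with exactly two positive elements. -/
theorem UniqueRelation.add_le_of_two_pos (hl : ∀ i, W i (Fin.last d) = 1)
    (hw : Submodule.span ℝ (Set.range fun i => castVec (W i)) = ⊤) {i2 i3 : ℕ}
    (h2 : 2 ≤ i2) (h23 : i2 ≤ i3) (hr : UniqueRelation (fun i => castVec (W i)) r)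
    {y : Fin (d + 1) → ℝ}
    (hmap : (Finset.univ : Finset (Σ B : OptBase W hr.objective, (B.cone _ hl).Q)).val.map
      (fun θ => (θ.1.cone _ hl).qhgt (θ.1.removed y) θ.2) = {0, 1, i2, i3})
    {j0 j1 : ι} (hj0 : 0 < r j0) (hj1 : 0 < r j1) (h01 : j0 ≠ j1)
    (hex : ∀ j, 0 < r j → j = j0 ∨ j = j1)
    (hrem0 : (hr.optBase hw hj0).removed y = ∅)
    (hrem1 : (hr.optBase hw hj1).removed y = {⟨j0, h01⟩}) : i2 + i3 ≤ d + 1 := by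
  obtain ⟨a, b, c, e, ha, hb, hc, he, hall, hab, hac, hae, hbc, hbe, hce⟩ :=
    exists_enumeration hmap
  set Q0 := ((hr.optBase hw hj0).cone _ hl).Q with hQ0
  set Q1 := ((hr.optBase hw hj1).cone _ hl).Q with hQ1
  set f : Q0 ⊕ Q1 → Σ B : OptBase W hr.objective, (B.cone _ hl).Q :=
    Sum.elim (fun x => ⟨hr.optBase hw hj0, x⟩) (fun x => ⟨hr.optBase hw hj1, x⟩) with hf
  have hne : hr.optBase hw hj0 ≠ hr.optBase hw hj1 := by
    intro h
    have h' : ({j0}ᶜ : Set ι) = {j1}ᶜ := congrArg Subtype.val h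
    exact h01 (Set.singleton_injective (compl_injective h'))
  have hinj : Function.Injective f := by
    rintro (x | x) (z | z) h
    · exact congrArg Sum.inl (eq_of_heq (Sigma.mk.inj h).2)
    · exact absurd (Sigma.mk.inj h).1 hne
    · exact absurd (Sigma.mk.inj h).1 hne.symm
    · exact congrArg Sum.inr (eq_of_heq (Sigma.mk.inj h).2)
  have hsurj : Function.Surjective f := by
    rintro ⟨B, x⟩
    obtain ⟨j, hj, rfl⟩ := hr.exists_eq_optBase hw B
    rcases hex j hj with rfl | rfl
    · exact ⟨.inl x, rfl⟩
    · exact ⟨.inr x, rfl⟩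
  set g0 : Q0 → ℕ := ((hr.optBase hw hj0).cone _ hl).qhgt ∅ with hg0
  set g1 : Q1 → ℕ := ((hr.optBase hw hj1).cone _ hl).qhgt {⟨j0, h01⟩} with hg1
  have hval : ∀ t, (((f t).1.cone _ hl).qhgt ((f t).1.removed y) (f t).2) = Sum.elim g0 g1 t := by
    rintro (x | x)
    · change ((hr.optBase hw hj0).cone _ hl).qhgt ((hr.optBase hw hj0).removed y) x = g0 x
      rw [hrem0]
    · change ((hr.optBase hw hj1).cone _ hl).qhgt ((hr.optBase hw hj1).removed y) x = g1 x
      rw [hrem1]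
  have v0 : Sum.elim g0 g1 (.inl 0) = 0 :=
    (SimplicialCone.qhgt_mk_zero _ _).trans (Set.ncard_empty _)
  have v1 : Sum.elim g0 g1 (.inr 0) = 1 :=
    (SimplicialCone.qhgt_mk_zero _ _).trans (Set.ncard_singleton _)
  obtain ⟨a, rfl⟩ := hsurj a
  obtain ⟨b, rfl⟩ := hsurj b
  obtain ⟨u, rfl⟩ := hsurj c
  obtain ⟨v, rfl⟩ := hsurj e
  rw [hval] at ha hb hc he
  rw [hinj.ne_iff] at hab hac hae hbc hbe hce
  have hall' : ∀ t, t = a ∨ t = b ∨ t = u ∨ t = v := fun t => by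
    simpa only [hinj.eq_iff] using hall (f t)
  obtain rfl : Sum.inl 0 = a := by
    have key : ∀ t, .inl 0 = t → Sum.elim g0 g1 t = 0 := fun t h => h ▸ v0
    rcases hall' (.inl 0) with h | h | h | h
    · exact h
    all_goals
      have := key _ h
      omega
  obtain rfl : Sum.inr 0 = b := by
    have key : ∀ t, .inr 0 = t → Sum.elim g0 g1 t = 1 := fun t h => h ▸ v1
    rcases hall' (.inr 0) with h | h | h | h
    · have := key _ h
      omega
    · exact h
    all_goals
      have := key _ h
      omega
  refine circuit_heights_le hce hac.symm hbc.symm hae.symm hbe.symm hall' hc he (fun x => ?_)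
    (fun z hz => hr.heights_of_second_base hw _ hl hj0 hj1 h01 z hz)
  exact (SimplicialCone.qhgt_add_qhgt_neg_le _ x).trans_eq (OptBase.card _)

theorem circuit_inequality (hl : ∀ i, W i (Fin.last d) = 1)
    (hw : Submodule.span ℝ (Set.range fun i => castVec (W i)) = ⊤)
    (hcard : Fintype.card ι = d + 2) {i2 i3 : ℕ} (h2 : 2 ≤ i2) (h23 : i2 ≤ i3)
    (h3 : i3 ≤ i2 + 1) (h3d : i3 ≤ d) (hd : 3 ≤ i2 ∨ d = 2)
    (hser : (1 - PowerSeries.X : PowerSeries ℤ) ^ (d + 1) * PowerSeries.mk (fun m => (Nat.card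
        {x : Fin (d + 1) → ℤ // InCone (fun i => castVec (W i)) (castVec x) ∧
          x (Fin.last d) = m} : ℤ)) =
        1 + PowerSeries.X ^ 1 + PowerSeries.X ^ i2 + PowerSeries.X ^ i3) :
    i2 + i3 ≤ d + 1 := by
  classical
  obtain ⟨r, hr⟩ := exists_uniqueRelation hw (by rw [hcard, Module.finrank_fin_fun])
  have hsum := hr.sum_eq_zero hl
  have hr0 : ∃ i ∈ Finset.univ, r i ≠ 0 := by
    obtain ⟨i, hi⟩ := Function.ne_iff.1 hr.ne_zero
    exact ⟨i, Finset.mem_univ i, hi⟩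
  obtain ⟨p, -, hp⟩ := Finset.exists_pos_of_sum_zero_of_exists_nonzero r hsum hr0
  obtain ⟨q, -, hq⟩ := Finset.exists_pos_of_sum_zero_of_exists_nonzero (fun i => -r i)
    (by rw [Finset.sum_neg_distrib, hsum, neg_zero])
    (by obtain ⟨i, hi, h⟩ := hr0; exact ⟨i, hi, neg_ne_zero.2 h⟩)
  have hq : r q < 0 := by linarith
  by_cases hone : ∀ j, j ≠ p → r j ≤ 0
  · have := hr.inequalities_of_pos hl hw hcard le_rfl (by omega) h23 hser hp hone
    omega
  by_cases hone' : ∀ j, j ≠ q → 0 ≤ r j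
  · have := hr.neg.inequalities_of_pos hl hw hcard le_rfl (by omega) h23 hser (i := q)
      (by simpa using hq) (fun j hj => by simpa using hone' j hj)
    omega
  push Not at hone hone'
  obtain ⟨p', hpp, hp'⟩ := hone
  obtain ⟨q', hqq, hq'⟩ := hone'
  obtain ⟨c, hc, hy⟩ := exists_genericVector (fun i => castVec (W i))
  rw [series_inCone _ hl hw hr.genericObjective hc hy] at hser
  have hmap := map_univ_eq_of_sum_X_pow hser
  set A : Finset ι := Finset.univ.filter fun i => 0 < r i with hA
  have memA : ∀ i, i ∈ A ↔ 0 < r i := fun i => by simp [hA]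
  obtain ⟨j0, hj0, hmin0⟩ := Finset.exists_min_image A (fun i => c i / r i)
    ⟨p, (memA p).2 hp⟩
  have hA1 : (A.erase j0).Nonempty := by
    by_cases h : p = j0
    · exact ⟨p', Finset.mem_erase.2 ⟨h ▸ hpp, (memA p').2 hp'⟩⟩
    · exact ⟨p, Finset.mem_erase.2 ⟨h, (memA p).2 hp⟩⟩
  obtain ⟨j1, hj1, hmin1⟩ := Finset.exists_min_image (A.erase j0) (fun i => c i / r i) hA1
  obtain ⟨h10, hj1⟩ := Finset.mem_erase.1 hj1
  have hp0 := (memA _).1 hj0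
  have hp1 := (memA _).1 hj1
  have lt01 : c j0 / r j0 < c j1 / r j1 :=
    lt_of_le_of_ne (hmin0 _ hj1) (hr.div_ne_div hw hy hp1 hp0 h10.symm)
  have third : ∀ j, 0 < r j → j = j0 ∨ j = j1 := by
    by_contra! hcon
    obtain ⟨p2, hp2, hp20, hp21⟩ := hcon
    rcases hd with hd | rfl
    · obtain ⟨j2, hj2, hmin2⟩ := Finset.exists_min_image ((A.erase j0).erase j1)
        (fun i => c i / r i) ⟨p2, by simp [memA, hp2, hp20, hp21]⟩
      obtain ⟨h21, hj2⟩ := Finset.mem_erase.1 hj2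
      have h12 := hmin1 _ hj2
      obtain ⟨h20, hj2⟩ := Finset.mem_erase.1 hj2
      have hpos2 := (memA _).1 hj2
      have lt12 : c j1 / r j1 < c j2 / r j2 :=
        lt_of_le_of_ne h12 (hr.div_ne_div hw hy hpos2 hp1 h21.symm)
      have hrem : (hr.optBase hw hpos2).removed (∑ i, c i • castVec (W i)) =
          {⟨j0, h20.symm⟩, ⟨j1, h21.symm⟩} := by
        ext j
        rw [hr.mem_removed_iff hw hc]
        simp only [Set.mem_insert_iff, Set.mem_singleton_iff, Subtype.ext_iff]
        constructor
        · rintro ⟨hj, hlt⟩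
          by_contra! hne
          exact hlt.not_ge (hmin2 j (by simp [memA, hj, hne]))
        · rintro (h | h)
          · rw [h]
            exact ⟨hp0, lt01.trans lt12⟩
          · rw [h]
            exact ⟨hp1, lt12⟩
      have hmem : 2 ∈ ({0, 1, i2, i3} : Multiset ℕ) := by
        rw [← hmap, Multiset.mem_map]
        refine ⟨⟨hr.optBase hw hpos2, 0⟩, Finset.mem_univ _, ?_⟩
        change SimplicialCone.qhgt _ ((hr.optBase hw hpos2).removed _) 0 = 2
        rw [hrem, SimplicialCone.qhgt_mk_zero, Set.ncard_pair]
        simpa [Subtype.ext_iff] using h10.symm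
      simp at hmem
      omega
    · have hcard5 : ({p2, j0, j1, q, q'} : Finset ι).card = 5 := by
        have : ∀ {a b}, 0 < r a → r b < 0 → a ≠ b := fun h h' e => by
          rw [e] at h
          exact absurd h h'.not_gt

        rw [Finset.card_insert_of_notMem, Finset.card_insert_of_notMem,
          Finset.card_insert_of_notMem, Finset.card_pair hqq.symm] <;>
        simp [hp20, hp21, h10.symm, this hp2 hq, this hp2 hq', this hp0 hq, this hp0 hq',
          this hp1 hq, this hp1 hq']
      have := Finset.card_le_univ ({p2, j0, j1, q, q'} : Finset ι)
      omega
  refine hr.add_le_of_two_pos hl hw h2 h23 hmap hp0 hp1 h10.symm third ?_ ?_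
  · ext j
    rw [hr.mem_removed_iff hw hc]
    simp only [Set.mem_empty_iff_false, iff_false, not_and, not_lt]
    exact fun hj => hmin0 j ((memA _).2 hj)
  · ext j
    rw [hr.mem_removed_iff hw hc, Set.mem_singleton_iff, Subtype.ext_iff]
    constructor
    · rintro ⟨hj, hlt⟩
      exact (third j hj).resolve_right j.2
    · intro h
      rw [h]
      exact ⟨hp0, lt01⟩

end CircuitInequality

theorem delta_poly_inequalities {d i1 i2 i3 : ℕ} (hi1 : 1 ≤ i1) (h12 : i1 ≤ i2)
    (h23 : i2 ≤ i3) (hi3d : i3 ≤ d) {P : Set (Fin d → ℝ)} (hP : IsLatticePolytope P)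
    (hspan : affineSpan ℝ P = ⊤) (hδ : HasDeltaPoly P (1 + X ^ i1 + X ^ i2 + X ^ i3)) :
    i3 ≤ i1 + i2 ∧ i1 + i3 ≤ d + 1 ∧ i2 ≤ (d + 1) / 2 ∧
      (2 * i2 ≤ i1 + i3 ∨ i2 + i3 ≤ d + 1) := by
  classical
  obtain ⟨ι, _, W, hinj, hl, hw, hcard, hser⟩ :=
    exists_lattice_generators hi1 (hi1.trans h12) (hi1.trans (h12.trans h23)) hP hspan hδ
  have hle : i2 < i3 → _ := fun h => card_generators_le hinj hl hw hi1 h12 h hi3d hser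
  rcases hi1.eq_or_lt with rfl | hi1
  · rcases h12.eq_or_lt with rfl | h12
    · rcases h23.eq_or_lt with rfl | h23
      · omega
      · have := hle h23
        split_ifs at this hcard <;> omega
    · have h3 : i3 ≤ i2 + 1 := by
        rcases h23.eq_or_lt with rfl | h23
        · omega
        · have := hle h23
          split_ifs at this hcard <;> omega
      rw [if_pos rfl, if_neg (by omega), if_neg (by omega)] at hcard
      by_cases hd : 3 ≤ i2 ∨ d = 2
      · have := circuit_inequality hl hw hcard h12 h23 h3 hi3d hd hser
        omega
      · omega
  · rw [if_neg (by omega), if_neg (by omega), if_neg (by omega)] at hcard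
    have := simplex_inequalities hl hw hcard hi1.le h12 h23 hser
    omega

/-- possible δ-polynomials `1 + t^{i₁} + t^{i₂} + t^{i₃}` (normalized volume 4). -/
theorem delta_poly_volume_four (d i1 i2 i3 : ℕ) (hd : 1 ≤ d) (hi1 : 1 ≤ i1) (h12 : i1 ≤ i2)
    (h23 : i2 ≤ i3) (hi3d : i3 ≤ d) :
    (∃ P : Set (Fin d → ℝ), IsLatticePolytope P ∧ affineSpan ℝ P = ⊤ ∧
      HasDeltaPoly P (1 + X ^ i1 + X ^ i2 + X ^ i3)) ↔
      i3 ≤ i1 + i2 ∧ i1 + i3 ≤ d + 1 ∧ i2 ≤ (d + 1) / 2 ∧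
        (2 * i2 ≤ i1 + i3 ∨ i2 + i3 ≤ d + 1) := by
  constructor
  · rintro ⟨P, hP, hspan, hδ⟩
    exact delta_poly_inequalities hi1 h12 h23 hi3d hP hspan hδ
  · rintro ⟨h1, h2, h3, h4 | h4⟩
    · exact exists_cyclic_simplex hd (by omega) h4 h1 h2
    · rw [add_assoc 1 (X ^ i1), add_comm (X ^ i1) (X ^ i2), ← add_assoc]
      exact exists_cyclic_simplex hd (by omega) (by omega) (by omega) h4
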